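/- Let N ≥ 1, 0 < γ < min{2,N}, p = p_F := 1 + 2/N, 0 < T < ∞ and z ∈ ℝ^N \ {0}. Set ψ(z) := |z|^{γ/(p−1)} if N > 2, and ψ(z) := |z|^{2/(p−1)} (1+|z|)^{−(2−γ)/(p−1)} if N ≤ 2. There exist constants c* > 0 and C* > 0 depending only on N, p, γ (and not on T or z) with the following property: if u₀ is a nonnegative measurable function on ℝ^N satisfying u₀(x) ≤ c ψ(z) |x−z|^{−N} (log(e+|x−z|^{−1}))^{−N/2−1} χ₁(|x−z|) + C₀ for all x ∈ ℝ^N \ {z}, where 0 < c ≤ c* (1 + T^{1/2} + T^{1−γ/2})^{−1/(p−1)} and 0 ≤ C₀ ≤ C* T^{−(2−γ)/(2(p−1))}, then the Hardy parabolic equation ∂_t u − Δu = |x|^{−γ} u^p with initial data u₀ possesses a solution on ℝ^N × [0,T). -/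

import Mathlib

open MeasureTheory Real Set

noncomputable def heatKernel (N : ℕ) (x : EuclideanSpace ℝ (Fin N)) (t : ℝ) : ℝ :=
  (4 * Real.pi * t) ^ (-(N : ℝ) / 2) * Real.exp (-‖x‖ ^ 2 / (4 * t))

/-- `u` is a (nonnegative, integral) solution of `∂_t u - Δu = |x|^{-γ} u^p`
with initial data the nonnegative measurable function `u₀`, on `ℝ^N × [0,T)`. -/
def IsSol (N : ℕ) (γ p T : ℝ) (u₀ : EuclideanSpace ℝ (Fin N) → ℝ)
    (u : EuclideanSpace ℝ (Fin N) → ℝ → ℝ) : Prop :=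
  Measurable (Function.uncurry u) ∧ (∀ x t, 0 ≤ u x t) ∧
    ∀ᵐ q : EuclideanSpace ℝ (Fin N) × ℝ,
      q.2 ∈ Set.Ioo 0 T →
        u q.1 q.2 = (∫ y, heatKernel N (q.1 - y) q.2 * u₀ y) +
          ∫ s in Set.Ioo 0 q.2, ∫ y,
            heatKernel N (q.1 - y) (q.2 - s) * ‖y‖ ^ (-γ) * u y s ^ p

open scoped ENNReal

/-- The logarithmic weight `r ↦ log (e + 1 / r)`. -/
noncomputable def logWeight (r : ℝ) : ℝ := Real.log (Real.exp 1 + r⁻¹)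

lemma one_le_logWeight {r : ℝ} (hr : 0 ≤ r) : 1 ≤ logWeight r := by
  have h : Real.exp 1 ≤ Real.exp 1 + r⁻¹ := by have := inv_nonneg.2 hr; linarith
  simpa [logWeight] using Real.log_le_log (Real.exp_pos 1) h

lemma logWeight_pos {r : ℝ} (hr : 0 ≤ r) : 0 < logWeight r :=
  one_pos.trans_le (one_le_logWeight hr)

lemma logWeight_anti {r r' : ℝ} (hr : 0 < r) (h : r ≤ r') : logWeight r' ≤ logWeight r := by
  have : r'⁻¹ ≤ r⁻¹ := inv_anti₀ hr h
  have h' : 0 < r'⁻¹ := inv_pos.2 (hr.trans_le h)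
  exact Real.log_le_log (by positivity) (by linarith)

@[fun_prop]
lemma measurable_logWeight : Measurable logWeight := by
  unfold logWeight; fun_prop

lemma logWeight_le_mul {δ ρ r : ℝ} (hδ : 0 < δ) (hρ : 0 < ρ) (h : ρ ≤ r) :
    logWeight ρ ≤ (1 + 1 / δ) * (r / ρ) ^ δ * logWeight r := by
  have hr : 0 < r := hρ.trans_le h
  have hl : 1 ≤ r / ρ := (one_le_div hρ).2 h
  have h1 : Real.exp 1 + ρ⁻¹ ≤ (Real.exp 1 + r⁻¹) * (r / ρ) := by
    have h2 : (Real.exp 1 + r⁻¹) * (r / ρ) = Real.exp 1 * (r / ρ) + ρ⁻¹ := by field_simp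
    have := Real.exp_pos 1
    nlinarith
  have h3 : logWeight ρ ≤ logWeight r + Real.log (r / ρ) := by
    have hm := Real.log_le_log (by positivity) h1
    rwa [Real.log_mul (by positivity) (by positivity)] at hm
  have h4 : Real.log (r / ρ) ≤ (r / ρ) ^ δ / δ := Real.log_le_rpow_div (by positivity) hδ
  have h5 : 1 ≤ (r / ρ) ^ δ := Real.one_le_rpow hl hδ.le
  have h6 := one_le_logWeight hr.le
  calc logWeight ρ ≤ logWeight r + (r / ρ) ^ δ / δ := by linarith
    _ ≤ (r / ρ) ^ δ * logWeight r + (r / ρ) ^ δ / δ * logWeight r := by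
        gcongr
        · nlinarith
        · exact le_mul_of_one_le_right (by positivity) h6
    _ = _ := by ring

/-- Powers times powers of the logarithmic weight are almost decreasing. -/
lemma rpow_mul_logWeight_le {a q ρ r : ℝ} (ha : 0 < a) (hq : 0 < q) (hρ : 0 < ρ) (h : ρ ≤ r) :
    r ^ (-a) * logWeight r ^ (-q) ≤
      (1 + q / a) ^ q * (ρ ^ (-a) * logWeight ρ ^ (-q)) := by
  have hr : 0 < r := hρ.trans_le h
  have h1 := logWeight_le_mul (δ := a / q) (by positivity) hρ h
  have hL := logWeight_pos hρ.le
  have hL' := logWeight_pos hr.le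
  have h2 := Real.rpow_le_rpow hL.le h1 hq.le
  rw [Real.mul_rpow (by positivity) hL'.le, Real.mul_rpow (by positivity) (by positivity),
    ← Real.rpow_mul (by positivity), div_mul_cancel₀ _ hq.ne', one_div_div,
    Real.div_rpow hr.le hρ.le] at h2
  rw [Real.rpow_neg hr.le, Real.rpow_neg hL'.le, Real.rpow_neg hρ.le, Real.rpow_neg hL.le,
    ← mul_inv, ← mul_inv, ← div_eq_mul_inv, inv_le_comm₀ (by positivity) (by positivity), inv_div,
    div_le_iff₀ (by positivity)]
  calc _ ≤ ρ ^ a * ((1 + q / a) ^ q * (r ^ a / ρ ^ a) * logWeight r ^ q) := by gcongr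
    _ = _ := by field_simp

lemma logWeight_neg_rpow_le_of_le {q ρ r : ℝ} (hq : 0 ≤ q) (hρ : 0 < ρ) (h : ρ ≤ r) :
    logWeight ρ ^ (-q) ≤ logWeight r ^ (-q) :=
  Real.rpow_le_rpow_of_nonpos (logWeight_pos (hρ.le.trans h)) (logWeight_anti hρ h) (by linarith)

lemma hasDerivAt_logWeight_rpow {κ r : ℝ} (hr : 0 < r) :
    HasDerivAt (fun r ↦ logWeight r ^ (-κ))
      (κ * (Real.exp 1 * r + 1)⁻¹ * (r⁻¹ * logWeight r ^ (-1 - κ))) r := by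
  have he := Real.exp_pos 1
  have h1 : HasDerivAt (fun r : ℝ ↦ Real.exp 1 + r⁻¹) (-(r ^ 2)⁻¹) r :=
    (hasDerivAt_inv hr.ne').const_add _
  have h2 : HasDerivAt logWeight _ r := h1.log (by positivity)
  have h3 := h2.rpow_const (p := -κ) (Or.inl (logWeight_pos hr.le).ne')
  convert h3 using 1
  rw [show -κ - 1 = -1 - κ by ring]
  field_simp

/-- The integral of the derivative of a nonnegative function over `(0, ρ)` is at most the
value of the function at `ρ`. -/
lemma lintegral_deriv_Ioo_le {f f' : ℝ → ℝ} {ρ : ℝ}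
    (hf : ∀ r ∈ Ioc 0 ρ, HasDerivAt f (f' r) r) (hf' : ∀ r ∈ Ioc 0 ρ, 0 ≤ f' r)
    (h0 : ∀ r ∈ Ioc 0 ρ, 0 ≤ f r) :
    ∫⁻ r in Ioo 0 ρ, ENNReal.ofReal (f' r) ≤ ENNReal.ofReal (f ρ) := by
  have hm : MonotoneOn f (Ioc 0 ρ) := by
    apply monotoneOn_of_deriv_nonneg (convex_Ioc 0 ρ)
    · exact fun x hx ↦ (hf x hx).continuousAt.continuousWithinAt
    · intro x hx
      exact (hf x (interior_subset hx)).differentiableAt.differentiableWithinAt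
    · intro x hx
      rw [(hf x (interior_subset hx)).deriv]
      exact hf' x (interior_subset hx)
  rw [lintegral_deriv_eq_volume_image_of_monotoneOn measurableSet_Ioo
    (fun x hx ↦ (hf x (Ioo_subset_Ioc_self hx)).hasDerivWithinAt) (hm.mono Ioo_subset_Ioc_self)]
  calc volume (f '' Ioo 0 ρ) ≤ volume (Icc 0 (f ρ)) := by
        apply measure_mono
        rintro _ ⟨r, hr, rfl⟩
        exact ⟨h0 r ⟨hr.1, hr.2.le⟩, hm ⟨hr.1, hr.2.le⟩ ⟨hr.1.trans hr.2, le_rfl⟩ hr.2.le⟩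
    _ = _ := by simp

lemma lintegral_inv_mul_logWeight_le {κ ρ : ℝ} (hκ : 0 < κ) :
    ∫⁻ r in Ioo 0 ρ, ENNReal.ofReal (r⁻¹ * logWeight r ^ (-1 - κ)) ≤
      ENNReal.ofReal ((Real.exp 1 * ρ + 1) / κ * logWeight ρ ^ (-κ)) := by
  rcases le_or_gt ρ 0 with hρ | hρ
  · simp [Ioo_eq_empty hρ.not_gt]
  have he := Real.exp_pos 1
  have hmain := lintegral_deriv_Ioo_le (ρ := ρ) (f := fun r ↦ logWeight r ^ (-κ))
    (fun r hr ↦ hasDerivAt_logWeight_rpow hr.1)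
    (fun r hr ↦ by have := hr.1; have := logWeight_pos hr.1.le; positivity)
    (fun r hr ↦ by have := logWeight_pos hr.1.le; positivity)
  calc _ ≤ ∫⁻ r in Ioo 0 ρ, ENNReal.ofReal ((Real.exp 1 * ρ + 1) / κ) * ENNReal.ofReal
        (κ * (Real.exp 1 * r + 1)⁻¹ * (r⁻¹ * logWeight r ^ (-1 - κ))) := by
        refine setLIntegral_mono' measurableSet_Ioo fun r hr ↦ ?_
        have hr0 := hr.1
        have hL := logWeight_pos hr0.le
        rw [← ENNReal.ofReal_mul (by positivity)]
        apply ENNReal.ofReal_le_ofReal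
        have h1 : 1 ≤ (Real.exp 1 * ρ + 1) * (Real.exp 1 * r + 1)⁻¹ := by
          rw [← div_eq_mul_inv, one_le_div (by positivity)]
          have := hr.2
          gcongr
        calc r⁻¹ * logWeight r ^ (-1 - κ)
            ≤ ((Real.exp 1 * ρ + 1) * (Real.exp 1 * r + 1)⁻¹) * (r⁻¹ * logWeight r ^ (-1 - κ)) :=
              le_mul_of_one_le_left (by positivity) h1
          _ = _ := by field_simp
    _ ≤ _ := by
        rw [lintegral_const_mul' _ _ ENNReal.ofReal_ne_top, ENNReal.ofReal_mul (by positivity)]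
        gcongr

lemma lintegral_inv_mul_logWeight_sqrt_le {β t : ℝ} (hβ : 0 < β) :
    ∫⁻ s in Ioo 0 t, ENNReal.ofReal (s⁻¹ * logWeight (√s) ^ (-1 - β)) ≤
      ENNReal.ofReal (2 * (Real.exp 1 * √t + 1) / β * logWeight (√t) ^ (-β)) := by
  rcases le_or_gt t 0 with ht | ht
  · simp [Ioo_eq_empty ht.not_gt]
  have he := Real.exp_pos 1
  have hd : ∀ s ∈ Ioc 0 t, HasDerivAt (fun s ↦ logWeight (√s) ^ (-β))
      (β / 2 * (Real.exp 1 * √s + 1)⁻¹ * (s⁻¹ * logWeight (√s) ^ (-1 - β))) s := by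
    intro s hs
    have hs0 : 0 < √s := Real.sqrt_pos.2 hs.1
    have h := (hasDerivAt_logWeight_rpow (κ := β) hs0).comp s (Real.hasDerivAt_sqrt hs.1.ne')
    refine h.congr_deriv ?_
    have : s⁻¹ = (√s)⁻¹ * (√s)⁻¹ := by rw [← mul_inv, Real.mul_self_sqrt hs.1.le]
    rw [this]
    field_simp
  have hmain := lintegral_deriv_Ioo_le (ρ := t) hd
    (fun r hr ↦ by have := hr.1; have := logWeight_pos (Real.sqrt_nonneg r); positivity)
    (fun r hr ↦ by have := logWeight_pos (Real.sqrt_nonneg r); positivity)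
  calc _ ≤ ∫⁻ r in Ioo 0 t, ENNReal.ofReal (2 * (Real.exp 1 * √t + 1) / β) * ENNReal.ofReal
        (β / 2 * (Real.exp 1 * √r + 1)⁻¹ * (r⁻¹ * logWeight (√r) ^ (-1 - β))) := by
        refine setLIntegral_mono' measurableSet_Ioo fun r hr ↦ ?_
        have hr0 := hr.1
        have hL := logWeight_pos (Real.sqrt_nonneg r)
        rw [← ENNReal.ofReal_mul (by positivity)]
        apply ENNReal.ofReal_le_ofReal
        have h1 : 1 ≤ (Real.exp 1 * √t + 1) * (Real.exp 1 * √r + 1)⁻¹ := by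
          rw [← div_eq_mul_inv, one_le_div (by positivity)]
          have := hr.2
          gcongr
        calc r⁻¹ * logWeight (√r) ^ (-1 - β)
            ≤ ((Real.exp 1 * √t + 1) * (Real.exp 1 * √r + 1)⁻¹) *
              (r⁻¹ * logWeight (√r) ^ (-1 - β)) :=
              le_mul_of_one_le_left (by positivity) h1
          _ = _ := by field_simp
    _ ≤ _ := by
        rw [lintegral_const_mul' _ _ ENNReal.ofReal_ne_top, ENNReal.ofReal_mul (by positivity)]
        gcongr

/-- `∫_0^t s^{-a} ds ≤ t^{1-a} / (1-a)` for `a < 1`. -/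
lemma lintegral_rpow_neg_le {a t : ℝ} (ha : a < 1) :
    ∫⁻ s in Ioo 0 t, ENNReal.ofReal (s ^ (-a)) ≤ ENNReal.ofReal (t ^ (1 - a) / (1 - a)) := by
  have ha' : 0 < 1 - a := by linarith
  refine lintegral_deriv_Ioo_le (f := fun s ↦ s ^ (1 - a) / (1 - a)) ?_ ?_ ?_
  · intro s hs
    have h := (Real.hasDerivAt_rpow_const (p := 1 - a) (Or.inl hs.1.ne')).div_const (1 - a)
    refine h.congr_deriv ?_
    rw [show 1 - a - 1 = -a by ring]
    field_simp
  · intro s hs; have := hs.1; positivity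
  · intro s hs; have := hs.1; positivity

lemma lintegral_sub_rpow_neg_le {a t : ℝ} (ha : a < 1) :
    ∫⁻ s in Ioo 0 t, ENNReal.ofReal ((t - s) ^ (-a)) ≤
      ENNReal.ofReal (t ^ (1 - a) / (1 - a)) := by
  refine le_trans (le_of_eq ?_) (lintegral_rpow_neg_le ha)
  rw [← lintegral_indicator measurableSet_Ioo, ← lintegral_indicator measurableSet_Ioo,
    ← lintegral_sub_left_eq_self (fun s ↦ (Ioo 0 t).indicator
      (fun s ↦ ENNReal.ofReal (s ^ (-a))) s) t]
  congr 1 with s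
  by_cases hs : s ∈ Ioo 0 t
  · have : t - s ∈ Ioo 0 t := ⟨by linarith [hs.2], by linarith [hs.1]⟩
    simp [hs, this]
  · have : t - s ∉ Ioo 0 t := fun h ↦ hs ⟨by linarith [h.2], by linarith [h.1]⟩
    simp [hs, this]

/-- Integration in polar coordinates for nonnegative radial functions. -/
lemma lintegral_fun_norm_addHaar {E : Type*} [NormedAddCommGroup E] [NormedSpace ℝ E]
    [Nontrivial E] [FiniteDimensional ℝ E] [MeasurableSpace E] [BorelSpace E] (μ : Measure E)
    [μ.IsAddHaarMeasure] {f : ℝ → ℝ≥0∞} (hf : Measurable f) :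
    ∫⁻ x, f ‖x‖ ∂μ = μ.toSphere univ *
      ∫⁻ y in Ioi (0 : ℝ), ENNReal.ofReal (y ^ (Module.finrank ℝ E - 1)) * f y := by
  have hm : Measurable (fun y : Ioi (0 : ℝ) ↦ f y) := hf.comp measurable_subtype_coe
  calc
    ∫⁻ x, f ‖x‖ ∂μ = ∫⁻ x : ({(0)}ᶜ : Set E), f ‖x.1‖ ∂(μ.comap (↑)) := by
      rw [lintegral_subtype_comap (measurableSet_singleton _).compl fun x ↦ f (‖x‖),
        restrict_compl_singleton]
    _ = ∫⁻ x, f x.2 ∂μ.toSphere.prod (.volumeIoiPow (Module.finrank ℝ E - 1)) := by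
      simpa using μ.measurePreserving_homeomorphUnitSphereProd.lintegral_comp_emb
        (Homeomorph.measurableEmbedding _) (f ∘ Subtype.val ∘ Prod.snd)
    _ = μ.toSphere univ * ∫⁻ x : Ioi (0 : ℝ), f x
          ∂.volumeIoiPow (Module.finrank ℝ E - 1) := by
      rw [lintegral_prod _ (by fun_prop)]
      simp [mul_comm]
    _ = _ := by
      rw [Measure.volumeIoiPow, lintegral_withDensity_eq_lintegral_mul _ (by fun_prop) hm]
      congr 1
      exact lintegral_subtype_comap measurableSet_Ioi
        fun y ↦ ENNReal.ofReal (y ^ (Module.finrank ℝ E - 1)) * f y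

/-- The radial profile `r^{-n} log(e + 1/r)^{-1-κ} 1_{[0,1]}(r)`. -/
noncomputable def logSing (n κ r : ℝ) : ℝ :=
  r ^ (-n) * logWeight r ^ (-1 - κ) * indicator (Icc (0 : ℝ) 1) (fun _ ↦ (1 : ℝ)) r

@[fun_prop]
lemma measurable_logSing (n κ : ℝ) : Measurable (logSing n κ) := by
  unfold logSing
  have : Measurable (indicator (Icc (0 : ℝ) 1) (fun _ ↦ (1 : ℝ))) :=
    measurable_const.indicator measurableSet_Icc
  fun_prop

lemma logSing_nonneg (n κ : ℝ) {r : ℝ} (hr : 0 ≤ r) : 0 ≤ logSing n κ r := by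
  have := logWeight_pos hr
  have h : 0 ≤ indicator (Icc (0 : ℝ) 1) (fun _ ↦ (1 : ℝ)) r :=
    indicator_nonneg (fun _ _ ↦ zero_le_one) _
  unfold logSing; positivity

lemma logSing_le (n κ : ℝ) {r : ℝ} (hr : 0 ≤ r) :
    logSing n κ r ≤ r ^ (-n) * logWeight r ^ (-1 - κ) := by
  have := logWeight_pos hr
  have h : indicator (Icc (0 : ℝ) 1) (fun _ ↦ (1 : ℝ)) r ≤ 1 :=
    indicator_le' (fun _ _ ↦ le_rfl) (fun _ _ ↦ zero_le_one) r
  exact mul_le_of_le_one_right (by positivity) h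

section

variable {N : ℕ}

lemma lintegral_norm_lt (hN : 1 ≤ N) {g : ℝ → ℝ} (hg : Measurable g) (ρ : ℝ) :
    ∫⁻ x : EuclideanSpace ℝ (Fin N) in {x | ‖x‖ < ρ}, ENNReal.ofReal (g ‖x‖) =
      (volume : Measure (EuclideanSpace ℝ (Fin N))).toSphere univ *
        ∫⁻ y in Ioo 0 ρ, ENNReal.ofReal (y ^ (N - 1) * g y) := by
  have : Nonempty (Fin N) := ⟨⟨0, hN⟩⟩
  have hm : Measurable ((Iio ρ).indicator fun r ↦ ENNReal.ofReal (g r)) :=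
    hg.ennreal_ofReal.indicator measurableSet_Iio
  have hs : MeasurableSet {x : EuclideanSpace ℝ (Fin N) | ‖x‖ < ρ} :=
    measurableSet_lt measurable_norm measurable_const
  have h := lintegral_fun_norm_addHaar
    (volume : Measure (EuclideanSpace ℝ (Fin N))) hm
  rw [finrank_euclideanSpace_fin] at h
  rw [← lintegral_indicator hs]
  refine Eq.trans (lintegral_congr fun x ↦ ?_) (h.trans ?_)
  · by_cases hx : ‖x‖ < ρ <;> simp [hx]
  · congr 1
    rw [← lintegral_indicator measurableSet_Ioi, ← lintegral_indicator measurableSet_Ioo]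
    refine lintegral_congr fun y ↦ ?_
    by_cases h0 : 0 < y
    · by_cases hy : y < ρ
      · simp [h0, hy, ENNReal.ofReal_mul (pow_nonneg h0.le (N - 1))]
      · simp [hy]
    · simp [h0]

lemma pow_pred_mul_rpow (hN : 1 ≤ N) {y : ℝ} (hy : 0 < y) (a : ℝ) :
    y ^ (N - 1) * y ^ a = y ^ ((N : ℝ) - 1 + a) := by
  rw [← Real.rpow_natCast, ← Real.rpow_add hy, Nat.cast_sub hN, Nat.cast_one]

lemma exists_lintegral_logSing_le (hN : 1 ≤ N) {κ : ℝ} (hκ : 0 < κ) :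
    ∃ C : ℝ, 0 < C ∧ ∀ ρ : ℝ, 0 < ρ →
      ∫⁻ x : EuclideanSpace ℝ (Fin N) in {x | ‖x‖ < ρ}, ENNReal.ofReal (logSing N κ ‖x‖) ≤
        ENNReal.ofReal (C * logWeight ρ ^ (-κ)) := by
  set σ := (volume : Measure (EuclideanSpace ℝ (Fin N))).toSphere univ
  have hσ : σ ≠ ∞ := measure_ne_top _ _
  have he := Real.exp_pos 1
  refine ⟨(σ.toReal + 1) * ((Real.exp 1 * 2 + 1) / κ), by positivity, fun ρ hρ ↦ ?_⟩
  have hL := logWeight_pos hρ.le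
  rw [lintegral_norm_lt hN (measurable_logSing _ _)]
  have h1 : ∫⁻ y in Ioo 0 ρ, ENNReal.ofReal (y ^ (N - 1) * logSing N κ y) ≤
      ENNReal.ofReal ((Real.exp 1 * 2 + 1) / κ * logWeight ρ ^ (-κ)) := by
    calc _ ≤ ∫⁻ y in Ioo 0 (min ρ 2), ENNReal.ofReal (y⁻¹ * logWeight y ^ (-1 - κ)) := by
          rw [← lintegral_indicator measurableSet_Ioo, ← lintegral_indicator measurableSet_Ioo]
          refine lintegral_mono fun y ↦ ?_
          by_cases h0 : y ∈ Ioo 0 ρ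
          · by_cases hy : y < 2
            · have h2 : y ∈ Ioo 0 (min ρ 2) := ⟨h0.1, lt_min h0.2 hy⟩
              simp only [h0, h2, indicator_of_mem]
              refine ENNReal.ofReal_le_ofReal ?_
              have h3 := pow_pred_mul_rpow hN h0.1 (-N)
              rw [show (N : ℝ) - 1 + -N = -1 by ring, Real.rpow_neg_one] at h3
              rw [← h3, mul_assoc]
              have := h0.1
              gcongr
              exact logSing_le _ _ h0.1.le
            · have : y ∉ Icc (0 : ℝ) 1 := fun h ↦ hy (h.2.trans_lt one_lt_two)
              simp [h0, logSing, this]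
          · simp [h0]
      _ ≤ _ := lintegral_inv_mul_logWeight_le hκ
      _ ≤ _ := by
          have hm : 0 < min ρ 2 := by positivity
          apply ENNReal.ofReal_le_ofReal
          have := logWeight_pos hm.le
          gcongr ?_ / κ * ?_
          · gcongr; exact min_le_right _ _
          · exact logWeight_neg_rpow_le_of_le hκ.le hm (min_le_left _ _)
  calc σ * _ ≤ ENNReal.ofReal (σ.toReal + 1) *
        ENNReal.ofReal ((Real.exp 1 * 2 + 1) / κ * logWeight ρ ^ (-κ)) := by
        gcongr
        rw [← ENNReal.ofReal_toReal hσ]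
        exact ENNReal.ofReal_le_ofReal (by simp)
    _ = _ := by rw [← ENNReal.ofReal_mul (by positivity), mul_assoc]

lemma exists_lintegral_norm_rpow_le (hN : 1 ≤ N) {γ : ℝ} (hγ : γ < N) :
    ∃ C : ℝ, 0 < C ∧ ∀ ρ : ℝ, 0 < ρ →
      ∫⁻ x : EuclideanSpace ℝ (Fin N) in {x | ‖x‖ < ρ}, ENNReal.ofReal (‖x‖ ^ (-γ)) ≤
        ENNReal.ofReal (C * ρ ^ (N - γ)) := by
  set σ := (volume : Measure (EuclideanSpace ℝ (Fin N))).toSphere univ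
  have hσ : σ ≠ ∞ := measure_ne_top _ _
  have hγ' : 0 < N - γ := by linarith
  refine ⟨(σ.toReal + 1) * (N - γ)⁻¹, by positivity, fun ρ hρ ↦ ?_⟩
  rw [lintegral_norm_lt hN (g := fun r ↦ r ^ (-γ)) (by fun_prop)]
  have h1 : ∫⁻ y in Ioo 0 ρ, ENNReal.ofReal (y ^ (N - 1) * y ^ (-γ)) ≤
      ENNReal.ofReal ((N - γ)⁻¹ * ρ ^ (N - γ)) := by
    have h := lintegral_rpow_neg_le (a := γ + 1 - N) (t := ρ) (by linarith)
    rw [show 1 - (γ + 1 - N) = N - γ by ring, div_eq_inv_mul] at h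
    refine le_trans (le_of_eq (setLIntegral_congr_fun measurableSet_Ioo fun y hy ↦ ?_)) h
    rw [pow_pred_mul_rpow hN hy.1]
    congr 2
    ring
  calc σ * _ ≤ ENNReal.ofReal (σ.toReal + 1) *
        ENNReal.ofReal ((N - γ)⁻¹ * ρ ^ (N - γ)) := by
        gcongr
        rw [← ENNReal.ofReal_toReal hσ]
        exact ENNReal.ofReal_le_ofReal (by simp)
    _ = _ := by rw [← ENNReal.ofReal_mul (by positivity), mul_assoc]

/-! ### The heat kernel -/

lemma heatKernel_nonneg (x : EuclideanSpace ℝ (Fin N)) {t : ℝ} (ht : 0 ≤ t) :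
    0 ≤ heatKernel N x t := by
  unfold heatKernel; positivity

lemma measurable_heatKernel :
    Measurable fun q : EuclideanSpace ℝ (Fin N) × ℝ ↦ heatKernel N q.1 q.2 := by
  unfold heatKernel; fun_prop

@[fun_prop]
lemma measurable_heatKernel_comp {α : Type*} [MeasurableSpace α] {f : α → EuclideanSpace ℝ (Fin N)}
    {g : α → ℝ} (hf : Measurable f) (hg : Measurable g) :
    Measurable fun a ↦ heatKernel N (f a) (g a) :=
  measurable_heatKernel.comp (hf.prodMk hg)

lemma heatKernel_prefactor_le {t : ℝ} (ht : 0 < t) :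
    (4 * π * t) ^ (-(N : ℝ) / 2) ≤ t ^ (-(N : ℝ) / 2) := by
  have hN : (0 : ℝ) ≤ N := Nat.cast_nonneg N
  apply Real.rpow_le_rpow_of_nonpos ht _ (by linarith)
  nlinarith [Real.pi_gt_three]

lemma heatKernel_le_rpow (x : EuclideanSpace ℝ (Fin N)) {t : ℝ} (ht : 0 < t) :
    heatKernel N x t ≤ t ^ (-(N : ℝ) / 2) := by
  have h : Real.exp (-‖x‖ ^ 2 / (4 * t)) ≤ 1 := by
    rw [Real.exp_le_one_iff, neg_div]
    exact neg_nonpos.2 (by positivity)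
  exact (mul_le_of_le_one_right (by positivity) h).trans (heatKernel_prefactor_le ht)

/-- Away from the origin the heat kernel is bounded uniformly in time. -/
lemma exists_heatKernel_le_of_le_norm (N : ℕ) :
    ∃ C : ℝ, 1 ≤ C ∧ ∀ (ρ t : ℝ) (x : EuclideanSpace ℝ (Fin N)), 0 < ρ → 0 < t →
      ρ / 4 ≤ ‖x‖ → heatKernel N x t ≤ C * ρ ^ (-(N : ℝ)) := by
  refine ⟨64 ^ N * N.factorial, ?_, fun ρ t x hρ ht hx ↦ ?_⟩
  · have h1 : (1 : ℝ) ≤ 64 ^ N := one_le_pow₀ (by norm_num)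
    have h2 : (1 : ℝ) ≤ N.factorial := by exact_mod_cast N.factorial_pos
    nlinarith
  set a : ℝ := ρ ^ 2 / t with ha
  have ha0 : 0 < a := by positivity
  have h1 : Real.exp (-‖x‖ ^ 2 / (4 * t)) ≤ Real.exp (-(a / 64)) := by
    apply Real.exp_le_exp.2
    rw [neg_div, neg_le_neg_iff, ha, div_div, div_le_div_iff₀ (by positivity) (by positivity)]
    nlinarith [mul_self_le_mul_self (by positivity) hx]
  have h2 : a ^ ((N : ℝ) / 2) * Real.exp (-(a / 64)) ≤ 64 ^ N * N.factorial := by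
    rw [Real.exp_neg, ← div_eq_mul_inv, div_le_iff₀ (Real.exp_pos _)]
    have hf : (1 : ℝ) ≤ N.factorial := by exact_mod_cast N.factorial_pos
    rcases le_total a 1 with h | h
    · have h3 : a ^ ((N : ℝ) / 2) ≤ 1 := Real.rpow_le_one ha0.le h (by positivity)
      have h4 : (1 : ℝ) ≤ 64 ^ N := one_le_pow₀ (by norm_num)
      have h5 : 1 ≤ Real.exp (a / 64) := Real.one_le_exp (by positivity)
      calc a ^ ((N : ℝ) / 2) ≤ 1 * 1 * 1 := by simpa using h3
        _ ≤ _ := by gcongr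
    · have h3 := Real.pow_div_factorial_le_exp (a / 64) (by positivity) N
      rw [div_le_iff₀ (by positivity), div_pow, div_le_iff₀ (by positivity)] at h3
      calc a ^ ((N : ℝ) / 2) ≤ a ^ (N : ℝ) :=
            Real.rpow_le_rpow_of_exponent_le h (by have : (0 : ℝ) ≤ N := N.cast_nonneg; linarith)
        _ = a ^ N := Real.rpow_natCast _ _
        _ ≤ _ := h3.trans (le_of_eq (by ring))
  have h3 : t ^ (-(N : ℝ) / 2) = ρ ^ (-(N : ℝ)) * a ^ ((N : ℝ) / 2) := by
    rw [ha, Real.div_rpow (by positivity) ht.le, ← Real.rpow_natCast, ← Real.rpow_mul hρ.le,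
      neg_div, Real.rpow_neg ht.le, Real.rpow_neg hρ.le]
    have : ρ ^ (((2 : ℕ) : ℝ) * ((N : ℝ) / 2)) = ρ ^ (N : ℝ) := by
      congr 1; push_cast; ring
    rw [this]
    have : ρ ^ (N : ℝ) ≠ 0 := by positivity
    field_simp
  calc heatKernel N x t ≤ t ^ (-(N : ℝ) / 2) * Real.exp (-(a / 64)) := by
        exact mul_le_mul (heatKernel_prefactor_le ht) h1 (Real.exp_pos _).le (by positivity)
    _ = ρ ^ (-(N : ℝ)) * (a ^ ((N : ℝ) / 2) * Real.exp (-(a / 64))) := by rw [h3]; ring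
    _ ≤ ρ ^ (-(N : ℝ)) * (64 ^ N * N.factorial) := by gcongr
    _ = _ := by ring

lemma lintegral_heatKernel (x : EuclideanSpace ℝ (Fin N)) {t : ℝ} (ht : 0 < t) :
    ∫⁻ y, ENNReal.ofReal (heatKernel N (y - x) t) = 1 := by
  rw [lintegral_sub_right_eq_self (fun y ↦ ENNReal.ofReal (heatKernel N y t)) x]
  have hb : 0 < 1 / (4 * t) := by positivity
  have hi := GaussianFourier.integral_rexp_neg_mul_sq_norm
    (V := EuclideanSpace ℝ (Fin N)) hb
  rw [finrank_euclideanSpace_fin] at hi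
  have hk : ∀ y : EuclideanSpace ℝ (Fin N), heatKernel N y t =
      (4 * π * t) ^ (-(N : ℝ) / 2) * Real.exp (-(1 / (4 * t)) * ‖y‖ ^ 2) := by
    intro y; unfold heatKernel; congr 2; ring
  have hint : Integrable (fun y : EuclideanSpace ℝ (Fin N) ↦
      Real.exp (-(1 / (4 * t)) * ‖y‖ ^ 2)) := by
    by_contra h
    rw [integral_undef h] at hi
    have : 0 < (π / (1 / (4 * t))) ^ ((N : ℝ) / 2) := by positivity
    linarith
  simp_rw [hk]
  rw [← ofReal_integral_eq_lintegral_ofReal (hint.const_mul _)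
    (Filter.Eventually.of_forall fun y ↦ by positivity), integral_const_mul, hi,
    show π / (1 / (4 * t)) = 4 * π * t by field_simp, ← Real.rpow_add (by positivity)]
  simp [neg_div]

lemma heatKernel_sub_comm (x y : EuclideanSpace ℝ (Fin N)) (t : ℝ) :
    heatKernel N (x - y) t = heatKernel N (y - x) t := by
  unfold heatKernel; rw [norm_sub_rev]

/-- The product of two heat kernels is a heat kernel times a constant. -/
lemma heatKernel_mul_heatKernel {a b : ℝ} (ha : 0 < a) (hb : 0 < b)
    (x y w : EuclideanSpace ℝ (Fin N)) :
    heatKernel N (x - y) a * heatKernel N (y - w) b =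
      heatKernel N (x - w) (a + b) *
        heatKernel N (y - (a + b)⁻¹ • (b • x + a • w)) (a * b / (a + b)) := by
  have hab : 0 < a + b := by positivity
  obtain ⟨p, rfl⟩ : ∃ p, x = y + p := ⟨x - y, by abel⟩
  obtain ⟨q, rfl⟩ : ∃ q, w = y - q := ⟨y - w, by abel⟩
  have e1 : y - (a + b)⁻¹ • (b • (y + p) + a • (y - q)) = (a + b)⁻¹ • (a • q - b • p) := by
    have : y = (a + b)⁻¹ • ((a + b) • y) := by
      rw [smul_smul, inv_mul_cancel₀ hab.ne', one_smul]
    nth_rewrite 1 [this]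
    rw [← smul_sub]
    congr 1
    module
  have e2 : y + p - y = p := by abel
  have e3 : y - (y - q) = q := by abel
  have e4 : y + p - (y - q) = p + q := by abel
  rw [e1, e2, e3, e4]
  unfold heatKernel
  rw [mul_mul_mul_comm, mul_mul_mul_comm ((4 * π * (a + b)) ^ (-(N : ℝ) / 2)),
    ← Real.mul_rpow (by positivity) (by positivity),
    ← Real.mul_rpow (by positivity) (by positivity), ← Real.exp_add, ← Real.exp_add]
  congr 2
  · field_simp
  · rw [norm_smul, mul_pow, norm_sub_sq_real, norm_add_sq_real, norm_smul, norm_smul,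
      real_inner_smul_left, real_inner_smul_right, real_inner_comm p q]
    simp only [Real.norm_eq_abs, abs_of_pos ha, abs_of_pos hb, abs_of_pos (inv_pos.2 hab), mul_pow]
    field_simp
    ring

/-- Integrating the weight `|y|^{-γ}` against a heat kernel. -/
lemma exists_lintegral_heatKernel_mul_norm_rpow_le (hN : 1 ≤ N) {γ : ℝ} (hγ0 : 0 < γ)
    (hγ : γ < N) :
    ∃ C : ℝ, 0 < C ∧ ∀ (m : EuclideanSpace ℝ (Fin N)) (τ : ℝ), 0 < τ →
      ∫⁻ y, ENNReal.ofReal (heatKernel N (y - m) τ) * ENNReal.ofReal (‖y‖ ^ (-γ)) ≤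
        ENNReal.ofReal (C * τ ^ (-(γ / 2))) := by
  obtain ⟨C, hC, h⟩ := exists_lintegral_norm_rpow_le hN hγ
  refine ⟨C + 1, by positivity, fun m τ hτ ↦ ?_⟩
  have hr : 0 < √τ := Real.sqrt_pos.2 hτ
  have hpow : ∀ a : ℝ, √τ ^ a = τ ^ (a / 2) := fun a ↦ by
    rw [Real.sqrt_eq_rpow, ← Real.rpow_mul hτ.le]; congr 1; ring
  have hs : MeasurableSet {x : EuclideanSpace ℝ (Fin N) | ‖x‖ < √τ} :=
    measurableSet_lt measurable_norm measurable_const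
  rw [← lintegral_add_compl _ hs, add_mul, ENNReal.ofReal_add (by positivity) (by positivity)]
  gcongr
  · calc _ ≤ ∫⁻ y : EuclideanSpace ℝ (Fin N) in {x | ‖x‖ < √τ},
          ENNReal.ofReal (τ ^ (-(N : ℝ) / 2)) * ENNReal.ofReal (‖y‖ ^ (-γ)) := by
          gcongr with y
          exact heatKernel_le_rpow _ hτ
      _ ≤ ENNReal.ofReal (τ ^ (-(N : ℝ) / 2)) * ENNReal.ofReal (C * √τ ^ (N - γ)) := by
          rw [lintegral_const_mul' _ _ ENNReal.ofReal_ne_top]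
          gcongr
          exact h _ hr
      _ = _ := by
          rw [← ENNReal.ofReal_mul (by positivity), hpow, mul_left_comm, ← Real.rpow_add hτ]
          congr 3
          ring
  · calc _ ≤ ∫⁻ y : EuclideanSpace ℝ (Fin N) in {x | ‖x‖ < √τ}ᶜ,
          ENNReal.ofReal (heatKernel N (y - m) τ) * ENNReal.ofReal (τ ^ (-(γ / 2))) := by
          refine setLIntegral_mono' hs.compl fun y hy ↦ ?_
          gcongr
          rw [← neg_div, ← hpow]
          exact Real.rpow_le_rpow_of_nonpos hr (by simpa using hy) (by linarith)
      _ ≤ ∫⁻ y : EuclideanSpace ℝ (Fin N),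
          ENNReal.ofReal (heatKernel N (y - m) τ) * ENNReal.ofReal (τ ^ (-(γ / 2))) :=
          setLIntegral_le_lintegral _ _
      _ = _ := by
          rw [lintegral_mul_const' _ _ ENNReal.ofReal_ne_top, lintegral_heatKernel _ hτ, one_mul,
            one_mul]

end

/-- The heat semigroup acting on `[0, ∞]`-valued functions. -/
noncomputable def heatExt {N : ℕ} (φ : EuclideanSpace ℝ (Fin N) → ℝ≥0∞)
    (x : EuclideanSpace ℝ (Fin N)) (t : ℝ) : ℝ≥0∞ :=
  ∫⁻ y, ENNReal.ofReal (heatKernel N (x - y) t) * φ y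

section

variable {N : ℕ} {φ : EuclideanSpace ℝ (Fin N) → ℝ≥0∞}

lemma measurable_heatExt (hφ : Measurable φ) :
    Measurable fun q : EuclideanSpace ℝ (Fin N) × ℝ ↦ heatExt φ q.1 q.2 := by
  unfold heatExt
  apply Measurable.lintegral_prod_right'
    (f := fun r : (EuclideanSpace ℝ (Fin N) × ℝ) × EuclideanSpace ℝ (Fin N) ↦
      ENNReal.ofReal (heatKernel N (r.1.1 - r.2) r.1.2) * φ r.2)
  fun_prop

/-- A weighted form of the semigroup property. -/
lemma lintegral_heatKernel_mul_weight_mul_heatExt (hφ : Measurable φ)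
    {W : EuclideanSpace ℝ (Fin N) → ℝ≥0∞} (hW : Measurable W) {a b : ℝ} (ha : 0 < a) (hb : 0 < b)
    (x : EuclideanSpace ℝ (Fin N)) :
    ∫⁻ y, ENNReal.ofReal (heatKernel N (x - y) a) * (W y * heatExt φ y b) =
      ∫⁻ w, ENNReal.ofReal (heatKernel N (x - w) (a + b)) * φ w *
        ∫⁻ y, ENNReal.ofReal (heatKernel N (y - (a + b)⁻¹ • (b • x + a • w))
          (a * b / (a + b))) * W y := by
  unfold heatExt
  calc _ = ∫⁻ y, ∫⁻ w, ENNReal.ofReal (heatKernel N (x - y) a) * (W y *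
        (ENNReal.ofReal (heatKernel N (y - w) b) * φ w)) := by
        refine lintegral_congr fun y ↦ ?_
        rw [lintegral_const_mul, lintegral_const_mul] <;> fun_prop
    _ = ∫⁻ w, ∫⁻ y, ENNReal.ofReal (heatKernel N (x - y) a) * (W y *
        (ENNReal.ofReal (heatKernel N (y - w) b) * φ w)) := by
        apply lintegral_lintegral_swap
        unfold Function.uncurry
        fun_prop
    _ = _ := by
        refine lintegral_congr fun w ↦ ?_
        rw [← lintegral_const_mul _ (by fun_prop)]
        refine lintegral_congr fun y ↦ ?_
        have h := congrArg ENNReal.ofReal (heatKernel_mul_heatKernel ha hb x y w)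
        rw [ENNReal.ofReal_mul (heatKernel_nonneg _ ha.le),
          ENNReal.ofReal_mul (heatKernel_nonneg _ (by positivity))] at h
        calc _ = ENNReal.ofReal (heatKernel N (x - y) a) * ENNReal.ofReal (heatKernel N (y - w) b) *
              (W y * φ w) := by ring
          _ = _ := by rw [h]; ring

lemma lintegral_heatKernel_mul_heatExt (hφ : Measurable φ) {a b : ℝ} (ha : 0 < a) (hb : 0 < b)
    (x : EuclideanSpace ℝ (Fin N)) :
    ∫⁻ y, ENNReal.ofReal (heatKernel N (x - y) a) * heatExt φ y b = heatExt φ x (a + b) := by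
  have h := lintegral_heatKernel_mul_weight_mul_heatExt hφ (W := fun _ ↦ 1) measurable_const
    ha hb x
  simp only [one_mul, mul_one] at h
  rw [h]
  refine lintegral_congr fun w ↦ ?_
  rw [lintegral_heatKernel _ (by positivity), mul_one]

lemma exists_lintegral_heatKernel_mul_norm_rpow_mul_heatExt_le (hN : 1 ≤ N) {γ : ℝ} (hγ0 : 0 < γ)
    (hγN : γ < N) (hγ2 : γ ≤ 2) :
    ∃ C : ℝ, 0 < C ∧ ∀ (φ : EuclideanSpace ℝ (Fin N) → ℝ≥0∞) (_ : Measurable φ)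
      (x : EuclideanSpace ℝ (Fin N)) (a b : ℝ), 0 < a → 0 < b →
      ∫⁻ y, ENNReal.ofReal (heatKernel N (x - y) a) *
          (ENNReal.ofReal (‖y‖ ^ (-γ)) * heatExt φ y b) ≤
        ENNReal.ofReal (C * (a ^ (-(γ / 2)) + b ^ (-(γ / 2)))) * heatExt φ x (a + b) := by
  obtain ⟨C, hC, h⟩ := exists_lintegral_heatKernel_mul_norm_rpow_le hN hγ0 hγN
  refine ⟨C, hC, fun φ hφ x a b ha hb ↦ ?_⟩
  rw [lintegral_heatKernel_mul_weight_mul_heatExt hφ (by fun_prop) ha hb, heatExt,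
    ← lintegral_const_mul' _ _ ENNReal.ofReal_ne_top]
  refine lintegral_mono fun w ↦ ?_
  rw [mul_comm]
  gcongr
  refine (h _ _ (by positivity)).trans (ENNReal.ofReal_le_ofReal ?_)
  gcongr
  have e : a * b / (a + b) = (a⁻¹ + b⁻¹)⁻¹ := by field_simp; ring
  rw [e, Real.inv_rpow (by positivity), Real.rpow_neg (by positivity), inv_inv, Real.rpow_neg ha.le,
    Real.rpow_neg hb.le, ← Real.inv_rpow ha.le, ← Real.inv_rpow hb.le]
  exact Real.rpow_add_le_add_rpow (by positivity) (by positivity) (by positivity) (by linarith)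

lemma heatExt_const (c : ℝ≥0∞) (x : EuclideanSpace ℝ (Fin N)) {t : ℝ} (ht : 0 < t) :
    heatExt (fun _ ↦ c) x t = c := by
  unfold heatExt
  simp_rw [heatKernel_sub_comm x]
  rw [lintegral_mul_const _ (by fun_prop), lintegral_heatKernel _ ht, one_mul]

lemma heatExt_mono {φ ψ : EuclideanSpace ℝ (Fin N) → ℝ≥0∞} (h : φ ≤ ψ)
    (x : EuclideanSpace ℝ (Fin N)) (t : ℝ) : heatExt φ x t ≤ heatExt ψ x t := by
  unfold heatExt
  gcongr with y
  exact h y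

lemma heatExt_add (hφ : Measurable φ) (ψ : EuclideanSpace ℝ (Fin N) → ℝ≥0∞)
    (x : EuclideanSpace ℝ (Fin N)) (t : ℝ) :
    heatExt (fun y ↦ φ y + ψ y) x t = heatExt φ x t + heatExt ψ x t := by
  unfold heatExt
  simp_rw [mul_add]
  exact lintegral_add_left (by fun_prop) _

lemma heatExt_const_mul (hφ : Measurable φ) (c : ℝ≥0∞)
    (x : EuclideanSpace ℝ (Fin N)) (t : ℝ) :
    heatExt (fun y ↦ c * φ y) x t = c * heatExt φ x t := by
  unfold heatExt
  simp_rw [mul_left_comm _ c]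
  exact lintegral_const_mul _ (by fun_prop)

end

/-- The radial singularity `logSing N κ` centred at `z`, as a `[0, ∞]`-valued function. -/
noncomputable def singData {N : ℕ} (κ : ℝ) (z x : EuclideanSpace ℝ (Fin N)) : ℝ≥0∞ :=
  ENNReal.ofReal (logSing N κ ‖x - z‖)

section

variable {N : ℕ}

@[fun_prop]
lemma measurable_singData (κ : ℝ) (z : EuclideanSpace ℝ (Fin N)) : Measurable (singData κ z) := by
  unfold singData; fun_prop

lemma exists_logSing_le_of_le (hN : 1 ≤ N) {κ : ℝ} (hκ : -1 < κ) :
    ∃ C : ℝ, 0 < C ∧ ∀ ρ r : ℝ, 0 < ρ → ρ ≤ r →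
      logSing N κ r ≤ C * (ρ ^ (-(N : ℝ)) * logWeight ρ ^ (-1 - κ)) := by
  have hN' : (0 : ℝ) < N := by exact_mod_cast hN
  have hq : 0 < 1 + κ := by linarith
  refine ⟨(1 + (1 + κ) / N) ^ (1 + κ), by positivity, fun ρ r hρ h ↦ ?_⟩
  have h1 := rpow_mul_logWeight_le hN' hq hρ h
  rw [show -(1 + κ) = -1 - κ by ring] at h1
  exact (logSing_le _ _ (hρ.le.trans h)).trans h1

lemma setLIntegral_singData (κ ρ : ℝ) (z : EuclideanSpace ℝ (Fin N)) :
    ∫⁻ x in {x | ‖x - z‖ < ρ}, singData κ z x =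
      ∫⁻ x : EuclideanSpace ℝ (Fin N) in {x | ‖x‖ < ρ}, ENNReal.ofReal (logSing N κ ‖x‖) := by
  have hs : MeasurableSet {x : EuclideanSpace ℝ (Fin N) | ‖x‖ < ρ} :=
    measurableSet_lt measurable_norm measurable_const
  have hs' : MeasurableSet {x : EuclideanSpace ℝ (Fin N) | ‖x - z‖ < ρ} :=
    measurableSet_lt (by fun_prop) measurable_const
  rw [← lintegral_indicator hs, ← lintegral_indicator hs',
    ← lintegral_sub_right_eq_self
      ({x | ‖x‖ < ρ}.indicator fun x ↦ ENNReal.ofReal (logSing N κ ‖x‖)) z]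
  rfl

/-- Sup bound for the heat evolution of the singular datum, at a point which either is at parabolic
scale `ρ` or lies at distance at least comparable to `ρ` from the singularity. -/
lemma exists_heatExt_singData_le (hN : 1 ≤ N) {κ A : ℝ} (hκ : 0 < κ) (hA : 0 < A) :
    ∃ C : ℝ, 0 < C ∧ ∀ (z y : EuclideanSpace ℝ (Fin N)) (ρ s : ℝ), 0 < ρ → 0 < s →
      (∀ x, ‖x - z‖ < ρ / 4 → heatKernel N (y - x) s ≤ A * ρ ^ (-(N : ℝ))) →
      heatExt (singData κ z) y s ≤
        ENNReal.ofReal (C * (ρ ^ (-(N : ℝ)) * logWeight ρ ^ (-κ))) := by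
  obtain ⟨C₁, hC₁, h₁⟩ := exists_lintegral_logSing_le hN hκ
  obtain ⟨C₂, hC₂, h₂⟩ := exists_logSing_le_of_le hN (κ := κ) (by linarith)
  refine ⟨A * C₁ + C₂ * (1 / 4) ^ (-(N : ℝ)), by positivity, fun z y ρ s hρ hs hk ↦ ?_⟩
  have hL := logWeight_pos hρ.le
  have hρ4 : 0 < ρ / 4 := by positivity
  have hms : MeasurableSet {x : EuclideanSpace ℝ (Fin N) | ‖x - z‖ < ρ / 4} :=
    measurableSet_lt (by fun_prop) measurable_const
  rw [heatExt, ← lintegral_add_compl _ hms, add_mul,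
    ENNReal.ofReal_add (by positivity) (by positivity)]
  gcongr
  · calc _ ≤ ∫⁻ x in {x | ‖x - z‖ < ρ / 4},
          ENNReal.ofReal (A * ρ ^ (-(N : ℝ))) * singData κ z x := by
          refine setLIntegral_mono' hms fun x hx ↦ ?_
          gcongr
          exact hk x hx
      _ ≤ ENNReal.ofReal (A * ρ ^ (-(N : ℝ))) * ENNReal.ofReal (C₁ * logWeight (ρ / 4) ^ (-κ)) := by
          rw [lintegral_const_mul' _ _ ENNReal.ofReal_ne_top, setLIntegral_singData]
          gcongr
          exact h₁ _ hρ4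
      _ ≤ _ := by
          rw [← ENNReal.ofReal_mul (by positivity)]
          apply ENNReal.ofReal_le_ofReal
          have := logWeight_neg_rpow_le_of_le hκ.le hρ4 (by linarith : ρ / 4 ≤ ρ)
          calc _ ≤ A * ρ ^ (-(N : ℝ)) * (C₁ * logWeight ρ ^ (-κ)) := by gcongr
            _ = _ := by ring
  · set B : ℝ := C₂ * (1 / 4) ^ (-(N : ℝ)) * (ρ ^ (-(N : ℝ)) * logWeight ρ ^ (-κ)) with hB
    calc _ ≤ ∫⁻ x in {x | ‖x - z‖ < ρ / 4}ᶜ,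
          ENNReal.ofReal (heatKernel N (y - x) s) * ENNReal.ofReal B := by
          refine setLIntegral_mono' hms.compl fun x hx ↦ ?_
          gcongr
          refine ENNReal.ofReal_le_ofReal ?_
          refine (h₂ (ρ / 4) _ hρ4 (by simpa using hx)).trans ?_
          rw [hB, mul_assoc C₂, show ρ / 4 = 1 / 4 * ρ by ring,
            Real.mul_rpow (by norm_num) hρ.le, mul_assoc ((1 / 4 : ℝ) ^ (-(N : ℝ)))]
          gcongr
          calc logWeight (1 / 4 * ρ) ^ (-1 - κ) ≤ logWeight ρ ^ (-1 - κ) := by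
                rw [show -1 - κ = -(1 + κ) by ring]
                exact logWeight_neg_rpow_le_of_le (by linarith) (by positivity) (by linarith)
            _ ≤ logWeight ρ ^ (-κ) :=
                Real.rpow_le_rpow_of_exponent_le (one_le_logWeight hρ.le) (by linarith)
      _ ≤ heatExt (fun _ ↦ ENNReal.ofReal B) y s := setLIntegral_le_lintegral _ _
      _ = _ := heatExt_const _ _ hs

lemma rpow_two_div_aux (hN : 1 ≤ N) {c ρ l e : ℝ} (hc : 0 ≤ c) (hρ : 0 < ρ) (hl : 0 < l) :
    (c * (ρ ^ (-(N : ℝ)) * l ^ e)) ^ (2 / (N : ℝ)) =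
      c ^ (2 / (N : ℝ)) * (ρ ^ (-2 : ℝ) * l ^ (e * (2 / N))) := by
  have hN' : (N : ℝ) ≠ 0 := by exact_mod_cast (by omega : N ≠ 0)
  rw [Real.mul_rpow hc (by positivity), Real.mul_rpow (by positivity) (by positivity),
    ← Real.rpow_mul hρ.le, ← Real.rpow_mul hl.le]
  congr 3
  field_simp

/-- The key pointwise bound on the nonlinearity for the supersolution. -/
lemma exists_rpow_le_mul_heatExt (hN : 1 ≤ N) {β A : ℝ} (hβ : 0 < β) (hβ1 : β < N / 2)
    (hβ2 : β ≤ 2 / N) (hA : 0 < A) :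
    ∃ C : ℝ, 0 < C ∧ ∀ (z y : EuclideanSpace ℝ (Fin N)) (ρ s : ℝ), 0 < ρ → 0 < s → √s ≤ ρ →
      (∀ x, ‖x - z‖ < ρ / 4 → heatKernel N (y - x) s ≤ A * ρ ^ (-(N : ℝ))) →
      (heatExt (singData (N / 2) z) y s +
          ENNReal.ofReal (logWeight (√s) ^ (-β)) * heatExt (singData (N / 2 - β) z) y s) ^
            (1 + 2 / (N : ℝ)) ≤
        ENNReal.ofReal (C * (ρ ^ (-2 : ℝ) * logWeight ρ ^ (-1 - β))) *
          heatExt (singData (N / 2 - β) z) y s := by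
  have hN' : (0 : ℝ) < N := by exact_mod_cast hN
  obtain ⟨C₁, hC₁, h₁⟩ := exists_heatExt_singData_le hN (κ := N / 2 - β) (by linarith) hA
  obtain ⟨C₂, hC₂, h₂⟩ := exists_logSing_le_of_le hN (κ := N / 2) (by linarith)
  set θ : ℝ := 2 / N with hθ
  have hθ0 : 0 < θ := by positivity
  refine ⟨2 ^ θ * (2 * (2 * C₁) ^ θ + C₂ ^ θ), by positivity, fun z y ρ s hρ hs hsρ hk ↦ ?_⟩
  set l := logWeight ρ with hl
  have hl1 : 1 ≤ l := one_le_logWeight hρ.le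
  have hl0 : 0 < l := one_pos.trans_le hl1
  set f : EuclideanSpace ℝ (Fin N) → ℝ≥0∞ := singData (N / 2) z with hf
  set F : EuclideanSpace ℝ (Fin N) → ℝ≥0∞ := singData (N / 2 - β) z with hF
  set f₂ : EuclideanSpace ℝ (Fin N) → ℝ≥0∞ := {x | ρ ≤ ‖x - z‖}.indicator f with hf2
  have hV := h₁ z y ρ s hρ hs hk
  have hsplit : ∀ x, logSing N (N / 2) ‖x - z‖ =
      logWeight ‖x - z‖ ^ (-β) * logSing N (N / 2 - β) ‖x - z‖ := by
    intro x
    have hL := logWeight_pos (norm_nonneg (x - z))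
    unfold logSing
    rw [show (-1 : ℝ) - N / 2 = -β + (-1 - (N / 2 - β)) by ring, Real.rpow_add hL]
    ring
  have hf_le : ∀ x, f x ≤ ENNReal.ofReal (l ^ (-β)) * F x + f₂ x := by
    intro x
    by_cases hx : ρ ≤ ‖x - z‖
    · have : f₂ x = f x := indicator_of_mem (s := {x | ρ ≤ ‖x - z‖}) hx f
      rw [this]; exact le_add_self
    · rcases eq_or_ne x z with rfl | hxz
      · have : f x = 0 := by
          simp [hf, singData, logSing, Real.zero_rpow (neg_ne_zero.2 hN'.ne')]
        simp [this]
      refine le_trans ?_ le_self_add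
      rw [hf, hF, singData, singData, ← ENNReal.ofReal_mul (by positivity), hsplit]
      refine ENNReal.ofReal_le_ofReal ?_
      have h0 : 0 < ‖x - z‖ := norm_pos_iff.2 (sub_ne_zero.2 hxz)
      exact mul_le_mul_of_nonneg_right
        (logWeight_neg_rpow_le_of_le hβ.le h0 (not_le.1 hx).le) (logSing_nonneg _ _ h0.le)
  have hf2F : f₂ ≤ F := by
    intro x
    refine (indicator_le_self _ _ x).trans ?_
    rw [hf, hF, singData, singData, hsplit]
    refine ENNReal.ofReal_le_ofReal (mul_le_of_le_one_left (logSing_nonneg _ _ (norm_nonneg _)) ?_)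
    exact Real.rpow_le_one_of_one_le_of_nonpos (one_le_logWeight (norm_nonneg _)) (by linarith)
  have hf2c : f₂ ≤ fun _ ↦ ENNReal.ofReal (C₂ * (ρ ^ (-(N : ℝ)) * l ^ (-1 - (N : ℝ) / 2))) := by
    intro x
    by_cases hx : ρ ≤ ‖x - z‖
    · have : f₂ x = f x := indicator_of_mem (s := {x | ρ ≤ ‖x - z‖}) hx f
      rw [this]
      exact ENNReal.ofReal_le_ofReal (h₂ _ _ hρ hx)
    · have : f₂ x = 0 := indicator_of_notMem (s := {x | ρ ≤ ‖x - z‖}) hx f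
      simp [this]
  have hFm : Measurable F := measurable_singData _ _
  set V := heatExt F y s
  set U₂ := heatExt f₂ y s
  have hU2V : U₂ ≤ V := heatExt_mono hf2F y s
  have hU2c : U₂ ≤ ENNReal.ofReal (C₂ * (ρ ^ (-(N : ℝ)) * l ^ (-1 - (N : ℝ) / 2))) :=
    (heatExt_mono hf2c y s).trans_eq (heatExt_const _ _ hs)
  have hU : heatExt f y s ≤ ENNReal.ofReal (l ^ (-β)) * V + U₂ := by
    refine (heatExt_mono hf_le y s).trans_eq ?_
    rw [heatExt_add (by fun_prop), heatExt_const_mul hFm]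
  have hw : heatExt f y s + ENNReal.ofReal (logWeight (√s) ^ (-β)) * V ≤
      ENNReal.ofReal (2 * l ^ (-β)) * V + U₂ := by
    have h3 : logWeight (√s) ^ (-β) ≤ l ^ (-β) :=
      logWeight_neg_rpow_le_of_le hβ.le (Real.sqrt_pos.2 hs) hsρ
    calc _ ≤ ENNReal.ofReal (l ^ (-β)) * V + U₂ + ENNReal.ofReal (l ^ (-β)) * V := by gcongr
      _ = _ := by rw [two_mul, ENNReal.ofReal_add (by positivity) (by positivity)]; ring
  have hmul : ∀ a : ℝ≥0∞, a ^ (1 + θ) = a * a ^ θ := fun a ↦ by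
    rw [ENNReal.rpow_add_of_nonneg _ _ zero_le_one hθ0.le, ENNReal.rpow_one]
  have ha : (ENNReal.ofReal (2 * l ^ (-β)) * V) ^ θ ≤
      ENNReal.ofReal ((2 * C₁) ^ θ * (ρ ^ (-2 : ℝ) * l ^ (-1 : ℝ))) := by
    calc _ ≤ (ENNReal.ofReal (2 * l ^ (-β)) * ENNReal.ofReal
          (C₁ * (ρ ^ (-(N : ℝ)) * l ^ (-((N : ℝ) / 2 - β))))) ^ θ := by gcongr
      _ = (ENNReal.ofReal (2 * C₁ * (ρ ^ (-(N : ℝ)) * l ^ (-((N : ℝ) / 2))))) ^ θ := by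
          rw [← ENNReal.ofReal_mul (by positivity),
            show -((N : ℝ) / 2) = -β + -((N : ℝ) / 2 - β) by ring, Real.rpow_add hl0]
          congr 2
          ring
      _ = _ := by
          rw [ENNReal.ofReal_rpow_of_nonneg (by positivity) hθ0.le,
            rpow_two_div_aux hN (by positivity) hρ hl0]
          congr 4
          field_simp
  have hb : U₂ ^ θ ≤ ENNReal.ofReal (C₂ ^ θ * (ρ ^ (-2 : ℝ) * l ^ (-1 - β))) := by
    calc _ ≤ (ENNReal.ofReal (C₂ * (ρ ^ (-(N : ℝ)) * l ^ (-1 - (N : ℝ) / 2)))) ^ θ := by gcongr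
      _ ≤ _ := by
          rw [ENNReal.ofReal_rpow_of_nonneg (by positivity) hθ0.le,
            rpow_two_div_aux hN (by positivity) hρ hl0]
          apply ENNReal.ofReal_le_ofReal
          gcongr ?_ * (?_ * ?_)
          apply Real.rpow_le_rpow_of_exponent_le hl1
          have : (-1 - (N : ℝ) / 2) * (2 / N) = -1 - 2 / N := by field_simp; ring
          rw [this]
          linarith
  calc _ ≤ (ENNReal.ofReal (2 * l ^ (-β)) * V + U₂) ^ (1 + θ) := by gcongr
    _ ≤ 2 ^ (1 + θ - 1) * ((ENNReal.ofReal (2 * l ^ (-β)) * V) ^ (1 + θ) + U₂ ^ (1 + θ)) :=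
        ENNReal.rpow_add_le_mul_rpow_add_rpow _ _ (by linarith)
    _ ≤ ENNReal.ofReal (2 ^ θ) * (ENNReal.ofReal (2 * l ^ (-β)) * V *
          ENNReal.ofReal ((2 * C₁) ^ θ * (ρ ^ (-2 : ℝ) * l ^ (-1 : ℝ))) +
          V * ENNReal.ofReal (C₂ ^ θ * (ρ ^ (-2 : ℝ) * l ^ (-1 - β)))) := by
        rw [hmul, hmul, add_sub_cancel_left,
          ← ENNReal.ofReal_rpow_of_nonneg zero_le_two hθ0.le, ENNReal.ofReal_ofNat]
        gcongr
    _ = ENNReal.ofReal (2 ^ θ) * (ENNReal.ofReal (2 * l ^ (-β)) *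
          ENNReal.ofReal ((2 * C₁) ^ θ * (ρ ^ (-2 : ℝ) * l ^ (-1 : ℝ))) +
          ENNReal.ofReal (C₂ ^ θ * (ρ ^ (-2 : ℝ) * l ^ (-1 - β)))) * V := by ring
    _ = _ := by
        rw [← ENNReal.ofReal_mul (by positivity), ← ENNReal.ofReal_add (by positivity)
          (by positivity), ← ENNReal.ofReal_mul (by positivity)]
        congr 2
        rw [show -1 - β = -β + -1 by ring, Real.rpow_add hl0]
        ring

end

section

variable {N : ℕ}

lemma rpow_mul_logWeight_max_le {γ β d s t : ℝ} (hγ0 : 0 < γ) (hγ2 : γ < 2) (hβ : 0 < β)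
    (hd : 0 < d) (hs : 0 < s) (hst : s < t) :
    d ^ γ * (max (√s) d ^ (-2 : ℝ) * logWeight (max (√s) d) ^ (-1 - β)) *
        ((t - s) ^ (-(γ / 2)) + s ^ (-(γ / 2))) ≤
      (1 + (1 + β) / (2 - γ)) ^ (1 + β) * (2 * (s⁻¹ * logWeight (√s) ^ (-1 - β)) +
        (1 + (1 + β) / (2 - γ)) ^ (1 + β) * 2 ^ ((2 - γ) / 2) *
          (t ^ (-((2 - γ) / 2)) * logWeight (√t) ^ (-1 - β)) * (t - s) ^ (-(γ / 2))) := by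
  have ht : 0 < t := hs.trans hst
  have hts : 0 < t - s := by linarith
  have ha : 0 < 2 - γ := by linarith
  have hq : 0 < 1 + β := by linarith
  have hs0 : 0 < √s := Real.sqrt_pos.2 hs
  set m := max (√s) d with hm
  have hm0 : 0 < m := hd.trans_le (le_max_right _ _)
  set C : ℝ := (1 + (1 + β) / (2 - γ)) ^ (1 + β) with hC
  have hC0 : 0 < C := by positivity
  have hsqrt : ∀ r : ℝ, 0 < r → √r ^ (-(2 - γ)) = r ^ (-((2 - γ) / 2)) := fun r hr ↦ by
    rw [Real.sqrt_eq_rpow, ← Real.rpow_mul hr.le]; congr 1; ring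
  have hLs := logWeight_pos hs0.le
  have hLm := logWeight_pos hm0.le
  have hLt := logWeight_pos (Real.sqrt_nonneg t)
  have eq' : -(1 + β) = -1 - β := by ring
  -- compare the scale `m` with the scale `√s`
  have h1 : d ^ γ * (m ^ (-2 : ℝ) * logWeight m ^ (-1 - β)) ≤
      C * (s ^ (-((2 - γ) / 2)) * logWeight (√s) ^ (-1 - β)) := by
    have h := rpow_mul_logWeight_le ha hq hs0 (le_max_left (√s) d)
    rw [eq', hsqrt s hs] at h
    refine le_trans ?_ h
    rw [← mul_assoc]
    gcongr
    calc d ^ γ * m ^ (-2 : ℝ) ≤ m ^ γ * m ^ (-2 : ℝ) := by gcongr; exact le_max_right _ _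
      _ = m ^ (-(2 - γ)) := by rw [← Real.rpow_add hm0]; congr 1; ring
  have h2 : s ^ (-((2 - γ) / 2)) * s ^ (-(γ / 2)) = s⁻¹ := by
    rw [← Real.rpow_add hs, ← Real.rpow_neg_one]; congr 1; ring
  have h3 : s ^ (-((2 - γ) / 2)) * logWeight (√s) ^ (-1 - β) * (t - s) ^ (-(γ / 2)) ≤
      s⁻¹ * logWeight (√s) ^ (-1 - β) + C * 2 ^ ((2 - γ) / 2) *
          (t ^ (-((2 - γ) / 2)) * logWeight (√t) ^ (-1 - β)) * (t - s) ^ (-(γ / 2)) := by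
    rcases le_total s (t / 2) with h | h
    · calc _ ≤ s ^ (-((2 - γ) / 2)) * logWeight (√s) ^ (-1 - β) * s ^ (-(γ / 2)) := by
            refine mul_le_mul_of_nonneg_left ?_ (by positivity)
            exact Real.rpow_le_rpow_of_nonpos hs (by linarith) (by linarith)
        _ = s⁻¹ * logWeight (√s) ^ (-1 - β) := by rw [← h2]; ring
        _ ≤ _ := le_add_of_nonneg_right (by positivity)
    · have ht2 : 0 < t / 2 := by positivity
      have h4 := rpow_mul_logWeight_le ha hq (Real.sqrt_pos.2 ht2) (Real.sqrt_le_sqrt h)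
      rw [eq', hsqrt s hs, hsqrt _ ht2] at h4
      have h5 : logWeight (√(t / 2)) ^ (-1 - β) ≤ logWeight (√t) ^ (-1 - β) := by
        rw [← eq']
        exact logWeight_neg_rpow_le_of_le hq.le (Real.sqrt_pos.2 ht2)
          (Real.sqrt_le_sqrt (by linarith))
      have h6 : (t / 2) ^ (-((2 - γ) / 2)) = 2 ^ ((2 - γ) / 2) * t ^ (-((2 - γ) / 2)) := by
        rw [Real.div_rpow ht.le zero_le_two, Real.rpow_neg zero_le_two, div_inv_eq_mul, mul_comm]
      calc _ ≤ C * (2 ^ ((2 - γ) / 2) * t ^ (-((2 - γ) / 2)) * logWeight (√t) ^ (-1 - β)) *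
            (t - s) ^ (-(γ / 2)) := by
            refine mul_le_mul_of_nonneg_right (h4.trans ?_) (by positivity)
            rw [h6]
            gcongr
        _ = C * 2 ^ ((2 - γ) / 2) *
          (t ^ (-((2 - γ) / 2)) * logWeight (√t) ^ (-1 - β)) * (t - s) ^ (-(γ / 2)) := by ring
        _ ≤ _ := le_add_of_nonneg_left (by positivity)
  calc _ ≤ C * (s ^ (-((2 - γ) / 2)) * logWeight (√s) ^ (-1 - β)) *
        ((t - s) ^ (-(γ / 2)) + s ^ (-(γ / 2))) :=
        mul_le_mul_of_nonneg_right h1 (by positivity)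
    _ = C * (s ^ (-((2 - γ) / 2)) * logWeight (√s) ^ (-1 - β) * (t - s) ^ (-(γ / 2)) +
          (s ^ (-((2 - γ) / 2)) * s ^ (-(γ / 2))) * logWeight (√s) ^ (-1 - β)) := by ring
    _ ≤ C * (s⁻¹ * logWeight (√s) ^ (-1 - β) + C * 2 ^ ((2 - γ) / 2) *
          (t ^ (-((2 - γ) / 2)) * logWeight (√t) ^ (-1 - β)) * (t - s) ^ (-(γ / 2)) +
          s⁻¹ * logWeight (√s) ^ (-1 - β)) := by rw [h2]; gcongr
    _ = _ := by ring

lemma measurable_heatExt_right {φ : EuclideanSpace ℝ (Fin N) → ℝ≥0∞} (hφ : Measurable φ) (t : ℝ) :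
    Measurable fun x ↦ heatExt φ x t :=
  Measurable.of_uncurry_right (f := fun x t ↦ heatExt φ x t) (measurable_heatExt hφ)

/-- The singular part of the supersolution. -/
noncomputable def singSuper {N : ℕ} (β : ℝ) (z y : EuclideanSpace ℝ (Fin N)) (s : ℝ) : ℝ≥0∞ :=
  heatExt (singData (N / 2) z) y s +
    ENNReal.ofReal (logWeight (√s) ^ (-β)) * heatExt (singData (N / 2 - β) z) y s

lemma exists_norm_rpow_mul_singSuper_rpow_le (hN : 1 ≤ N) {β γ : ℝ} (hβ : 0 < β)
    (hβ1 : β < N / 2) (hβ2 : β ≤ 2 / N) (hγ : 0 < γ) :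
    ∃ C : ℝ, 0 < C ∧ ∀ (z y : EuclideanSpace ℝ (Fin N)) (s : ℝ), z ≠ 0 → 0 < s →
      ENNReal.ofReal (‖y‖ ^ (-γ)) * singSuper β z y s ^ (1 + 2 / (N : ℝ)) ≤
        (ENNReal.ofReal (C * ‖z‖ ^ (-γ) * (s⁻¹ * logWeight (√s) ^ (-1 - β))) +
          ENNReal.ofReal (C * (max (√s) ‖z‖ ^ (-2 : ℝ) *
            logWeight (max (√s) ‖z‖) ^ (-1 - β))) * ENNReal.ofReal (‖y‖ ^ (-γ))) *
          heatExt (singData (N / 2 - β) z) y s := by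
  obtain ⟨A, hA, hk⟩ := exists_heatKernel_le_of_le_norm N
  obtain ⟨C, hC, h⟩ := exists_rpow_le_mul_heatExt hN hβ hβ1 hβ2 (one_pos.trans_le hA)
  refine ⟨C * 2 ^ γ + C, by positivity, fun z y s hz hs ↦ ?_⟩
  have hd : 0 < ‖z‖ := norm_pos_iff.2 hz
  have hs0 : 0 < √s := Real.sqrt_pos.2 hs
  have hLs := logWeight_pos hs0.le
  have hpar : ∀ x, ‖x - z‖ < √s / 4 → heatKernel N (y - x) s ≤ A * √s ^ (-(N : ℝ)) := by
    intro x _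
    have e : √s ^ (-(N : ℝ)) = s ^ (-(N : ℝ) / 2) := by
      rw [Real.sqrt_eq_rpow, ← Real.rpow_mul hs.le]; congr 1; ring
    rw [e]
    exact (heatKernel_le_rpow _ hs).trans (le_mul_of_one_le_left (by positivity) hA)
  have hs2 : √s ^ (-2 : ℝ) = s⁻¹ := by
    rw [Real.sqrt_eq_rpow, ← Real.rpow_mul hs.le, ← Real.rpow_neg_one]; norm_num
  rcases le_or_gt (‖z‖ / 2) ‖y‖ with hy | hy
  · have h1 := h z y (√s) s hs0 hs le_rfl hpar
    rw [hs2] at h1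
    have h2 : ‖y‖ ^ (-γ) ≤ 2 ^ γ * ‖z‖ ^ (-γ) := by
      refine (Real.rpow_le_rpow_of_nonpos (by positivity) hy (by linarith)).trans_eq ?_
      rw [Real.div_rpow hd.le zero_le_two, Real.rpow_neg zero_le_two, div_inv_eq_mul, mul_comm]
    calc _ ≤ ENNReal.ofReal (2 ^ γ * ‖z‖ ^ (-γ)) *
          (ENNReal.ofReal (C * (s⁻¹ * logWeight (√s) ^ (-1 - β))) *
            heatExt (singData (N / 2 - β) z) y s) := by
          unfold singSuper; gcongr
      _ = ENNReal.ofReal (C * 2 ^ γ * ‖z‖ ^ (-γ) * (s⁻¹ * logWeight (√s) ^ (-1 - β))) *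
            heatExt (singData (N / 2 - β) z) y s := by
          rw [← mul_assoc, ← ENNReal.ofReal_mul (by positivity)]; congr 2; ring
      _ ≤ _ := by
          gcongr
          refine le_trans (ENNReal.ofReal_le_ofReal ?_) le_self_add
          gcongr
          linarith
  · set m := max (√s) ‖z‖ with hm
    have hm0 : 0 < m := hs0.trans_le (le_max_left _ _)
    have hkm : ∀ x, ‖x - z‖ < m / 4 → heatKernel N (y - x) s ≤ A * m ^ (-(N : ℝ)) := by
      rcases le_total (‖z‖) (√s) with hzs | hzs
      · rwa [hm, max_eq_left hzs]
      · rw [hm, max_eq_right hzs]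
        intro x hx
        refine hk _ _ _ hd hs ?_
        have h3 : ‖z‖ ≤ ‖x - z‖ + ‖y - x‖ + ‖y‖ := by
          calc ‖z‖ = ‖-(x - z) - (y - x) + y‖ := by congr 1; abel
            _ ≤ ‖-(x - z)‖ + ‖y - x‖ + ‖y‖ := by
                refine (norm_add_le _ _).trans ?_
                gcongr
                exact norm_sub_le _ _
            _ = _ := by rw [norm_neg]
        linarith
    have h1 := h z y m s hm0 hs (le_max_left _ _) hkm
    have hLm := logWeight_pos hm0.le
    calc _ ≤ ENNReal.ofReal (‖y‖ ^ (-γ)) *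
          (ENNReal.ofReal (C * (m ^ (-2 : ℝ) * logWeight m ^ (-1 - β))) *
            heatExt (singData (N / 2 - β) z) y s) := by
          unfold singSuper; gcongr
      _ = ENNReal.ofReal (C * (m ^ (-2 : ℝ) * logWeight m ^ (-1 - β))) *
          ENNReal.ofReal (‖y‖ ^ (-γ)) * heatExt (singData (N / 2 - β) z) y s := by ring
      _ ≤ _ := by
          gcongr
          refine le_trans ?_ le_add_self
          gcongr
          have : 0 < C * 2 ^ γ := by positivity
          linarith

/-- The Duhamel term of the singular part of the supersolution is controlled. -/
lemma exists_duhamel_singSuper_le (hN : 1 ≤ N) {β γ : ℝ} (hβ : 0 < β)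
    (hβ1 : β < N / 2) (hβ2 : β ≤ 2 / N) (hγ : 0 < γ) (hγ2 : γ < 2) (hγN : γ < N) :
    ∃ C : ℝ, 0 < C ∧ ∀ (z x : EuclideanSpace ℝ (Fin N)) (t : ℝ), z ≠ 0 → 0 < t →
      ∫⁻ s in Ioo 0 t, ∫⁻ y, ENNReal.ofReal (heatKernel N (x - y) (t - s)) *
          (ENNReal.ofReal (‖y‖ ^ (-γ)) * singSuper β z y s ^ (1 + 2 / (N : ℝ))) ≤
        ENNReal.ofReal (C * (1 + √t) * ‖z‖ ^ (-γ)) *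
          (ENNReal.ofReal (logWeight (√t) ^ (-β)) * heatExt (singData (N / 2 - β) z) x t) := by
  obtain ⟨C₁, hC₁, h₁⟩ := exists_norm_rpow_mul_singSuper_rpow_le hN hβ hβ1 hβ2 hγ
  obtain ⟨C₂, hC₂, h₂⟩ :=
    exists_lintegral_heatKernel_mul_norm_rpow_mul_heatExt_le hN hγ hγN hγ2.le
  have he := Real.exp_pos 1
  have ha : 0 < 2 - γ := by linarith
  obtain ⟨B, hB⟩ : ∃ B : ℝ, B = (1 + (1 + β) / (2 - γ)) ^ (1 + β) := ⟨_, rfl⟩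
  have hB0 : 0 < B := by rw [hB]; positivity
  obtain ⟨B', hB'⟩ : ∃ B' : ℝ, B' = B * 2 ^ ((2 - γ) / 2) := ⟨_, rfl⟩
  have hB'0 : 0 < B' := by rw [hB']; positivity
  obtain ⟨P, hP⟩ : ∃ P : ℝ, P = C₁ + C₁ * C₂ * B * 2 := ⟨_, rfl⟩
  obtain ⟨Q, hQ⟩ : ∃ Q : ℝ, Q = C₁ * C₂ * B * B' := ⟨_, rfl⟩
  have hP0 : 0 < P := by rw [hP]; positivity
  have hQ0 : 0 < Q := by rw [hQ]; positivity
  refine ⟨P * (2 * Real.exp 1 / β + 2 / β) + Q * (1 - γ / 2)⁻¹, ?_, fun z x t hz ht ↦ ?_⟩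
  · have : 0 < 1 - γ / 2 := by linarith
    positivity
  have hd : 0 < ‖z‖ := norm_pos_iff.2 hz
  have hγ' : 0 < 1 - γ / 2 := by linarith
  obtain ⟨V, hV⟩ : ∃ V : EuclideanSpace ℝ (Fin N) → ℝ → ℝ≥0∞,
      ∀ y s, heatExt (singData (N / 2 - β) z) y s = V y s := ⟨_, fun _ _ ↦ rfl⟩
  have hF : Measurable (singData (N / 2 - β) z) := measurable_singData _ _
  have hLt := logWeight_pos (Real.sqrt_nonneg t)
  rw [hV]
  replace h₁ := h₁ z
  simp only [hV] at h₁
  obtain ⟨g, hg⟩ : ∃ g : ℝ → ℝ, ∀ s, g s = s⁻¹ * logWeight (√s) ^ (-1 - β) := ⟨_, fun _ ↦ rfl⟩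
  obtain ⟨J, hJ⟩ : ∃ J : ℝ, J = t ^ (-((2 - γ) / 2)) * logWeight (√t) ^ (-1 - β) := ⟨_, rfl⟩
  have hJ0 : 0 < J := by rw [hJ]; positivity
  have hinner : ∀ s ∈ Ioo 0 t, ∫⁻ y, ENNReal.ofReal (heatKernel N (x - y) (t - s)) *
      (ENNReal.ofReal (‖y‖ ^ (-γ)) * singSuper β z y s ^ (1 + 2 / (N : ℝ))) ≤
      (ENNReal.ofReal (P * ‖z‖ ^ (-γ)) * ENNReal.ofReal (g s) +
        ENNReal.ofReal (Q * J * ‖z‖ ^ (-γ)) * ENNReal.ofReal ((t - s) ^ (-(γ / 2)))) * V x t := by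
    intro s hs
    have hs0 : 0 < s := hs.1
    have hts : 0 < t - s := by linarith [hs.2]
    have hLs := logWeight_pos (Real.sqrt_nonneg s)
    have hg0 : 0 < g s := by rw [hg]; positivity
    set k : ℝ := max (√s) ‖z‖ ^ (-2 : ℝ) * logWeight (max (√s) ‖z‖) ^ (-1 - β) with hk
    have hk0 : 0 < k := by
      have hm : 0 < max (√s) ‖z‖ := hd.trans_le (le_max_right _ _)
      have := logWeight_pos hm.le
      positivity
    have hVm : Measurable fun y ↦ V y s := by
      simpa only [← hV] using measurable_heatExt_right hF s
    calc _ ≤ ∫⁻ y, (ENNReal.ofReal (C₁ * ‖z‖ ^ (-γ) * g s) *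
          (ENNReal.ofReal (heatKernel N (x - y) (t - s)) * V y s) + ENNReal.ofReal (C₁ * k) *
          (ENNReal.ofReal (heatKernel N (x - y) (t - s)) *
            (ENNReal.ofReal (‖y‖ ^ (-γ)) * V y s))) := by
          refine lintegral_mono fun y ↦ ?_
          refine (mul_le_mul_right (h₁ y s hz hs0) _).trans_eq ?_
          rw [hg]
          ring
      _ = ENNReal.ofReal (C₁ * ‖z‖ ^ (-γ) * g s) *
          (∫⁻ y, ENNReal.ofReal (heatKernel N (x - y) (t - s)) * V y s) + ENNReal.ofReal (C₁ * k) *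
          ∫⁻ y, (ENNReal.ofReal (heatKernel N (x - y) (t - s)) *
            (ENNReal.ofReal (‖y‖ ^ (-γ)) * V y s)) := by
          have hk1 : Measurable fun y ↦ heatKernel N (x - y) (t - s) :=
            measurable_heatKernel_comp (by fun_prop) measurable_const
          rw [lintegral_add_left (by fun_prop), lintegral_const_mul' _ _ ENNReal.ofReal_ne_top,
            lintegral_const_mul' _ _ ENNReal.ofReal_ne_top]
      _ ≤ ENNReal.ofReal (C₁ * ‖z‖ ^ (-γ) * g s) * V x t + ENNReal.ofReal (C₁ * k) *
          (ENNReal.ofReal (C₂ * ((t - s) ^ (-(γ / 2)) + s ^ (-(γ / 2)))) * V x t) := by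
          have e : t - s + s = t := by ring
          have e1 := lintegral_heatKernel_mul_heatExt hF hts hs0 x
          have e2 := h₂ _ hF x (t - s) s hts hs0
          simp only [e, hV] at e1 e2
          exact add_le_add (mul_le_mul_right e1.le _) (mul_le_mul_right e2 _)
      _ = ENNReal.ofReal (C₁ * ‖z‖ ^ (-γ) * g s +
          C₁ * k * (C₂ * ((t - s) ^ (-(γ / 2)) + s ^ (-(γ / 2))))) * V x t := by
          rw [← mul_assoc (ENNReal.ofReal (C₁ * k)), ← ENNReal.ofReal_mul (by positivity),
            ← add_mul, ENNReal.ofReal_add (by positivity) (by positivity)]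
      _ ≤ ENNReal.ofReal (P * ‖z‖ ^ (-γ) * g s +
            Q * J * ‖z‖ ^ (-γ) * (t - s) ^ (-(γ / 2))) * V x t := by
          refine mul_le_mul_left (ENNReal.ofReal_le_ofReal ?_) _
          have h3 := rpow_mul_logWeight_max_le hγ hγ2 hβ hd hs0 hs.2
          rw [← hB, ← hB', ← hJ, ← hg] at h3
          have hz1 : ‖z‖ ^ (-γ) * ‖z‖ ^ γ = 1 := by
            rw [← Real.rpow_add hd]; simp
          calc _ = C₁ * ‖z‖ ^ (-γ) * g s + C₁ * C₂ * (‖z‖ ^ (-γ) * ‖z‖ ^ γ) * k *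
                ((t - s) ^ (-(γ / 2)) + s ^ (-(γ / 2))) := by rw [hz1]; ring
            _ = C₁ * ‖z‖ ^ (-γ) * g s + C₁ * C₂ * ‖z‖ ^ (-γ) * (‖z‖ ^ γ * k *
                ((t - s) ^ (-(γ / 2)) + s ^ (-(γ / 2)))) := by ring
            _ ≤ C₁ * ‖z‖ ^ (-γ) * g s + C₁ * C₂ * ‖z‖ ^ (-γ) *
                (B * (2 * g s + B' * J * (t - s) ^ (-(γ / 2)))) := by
                gcongr
            _ = _ := by rw [hP, hQ]; ring
      _ = _ := by
          rw [ENNReal.ofReal_add (by positivity) (by positivity),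
            ENNReal.ofReal_mul (by positivity : 0 ≤ P * ‖z‖ ^ (-γ)),
            ENNReal.ofReal_mul (by positivity : 0 ≤ Q * J * ‖z‖ ^ (-γ))]
  have hgm : Measurable g := by rw [funext hg]; fun_prop
  have hV_ne : ∫⁻ s in Ioo 0 t, (ENNReal.ofReal (P * ‖z‖ ^ (-γ)) * ENNReal.ofReal (g s) +
        ENNReal.ofReal (Q * J * ‖z‖ ^ (-γ)) * ENNReal.ofReal ((t - s) ^ (-(γ / 2)))) * V x t =
      (ENNReal.ofReal (P * ‖z‖ ^ (-γ)) * (∫⁻ s in Ioo 0 t, ENNReal.ofReal (g s)) +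
        ENNReal.ofReal (Q * J * ‖z‖ ^ (-γ)) *
          ∫⁻ s in Ioo 0 t, ENNReal.ofReal ((t - s) ^ (-(γ / 2)))) * V x t := by
    rw [lintegral_mul_const _ (by fun_prop), lintegral_add_left (by fun_prop),
      lintegral_const_mul' _ _ ENNReal.ofReal_ne_top,
      lintegral_const_mul' _ _ ENNReal.ofReal_ne_top]
  calc _ ≤ _ := setLIntegral_mono' measurableSet_Ioo hinner
    _ = _ := hV_ne
    _ ≤ (ENNReal.ofReal (P * ‖z‖ ^ (-γ)) *
          ENNReal.ofReal (2 * (Real.exp 1 * √t + 1) / β * logWeight (√t) ^ (-β)) +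
        ENNReal.ofReal (Q * J * ‖z‖ ^ (-γ)) *
          ENNReal.ofReal (t ^ (1 - γ / 2) / (1 - γ / 2))) * V x t := by
        gcongr
        · simp only [hg]; exact lintegral_inv_mul_logWeight_sqrt_le hβ
        · exact lintegral_sub_rpow_neg_le (by linarith)
    _ ≤ _ := by
        rw [← mul_assoc, ← ENNReal.ofReal_mul (by positivity), ← ENNReal.ofReal_mul (by positivity),
          ← ENNReal.ofReal_mul (by positivity),
          ← ENNReal.ofReal_add (by positivity) (by positivity)]
        gcongr
        have h4 : J * t ^ (1 - γ / 2) = logWeight (√t) ^ (-1 - β) := by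
          rw [hJ, mul_right_comm, ← Real.rpow_add ht]
          rw [show -((2 - γ) / 2) + (1 - γ / 2) = 0 by ring, Real.rpow_zero, one_mul]
        have h5 : logWeight (√t) ^ (-1 - β) ≤ (1 + √t) * logWeight (√t) ^ (-β) := by
          calc _ ≤ logWeight (√t) ^ (-β) :=
                Real.rpow_le_rpow_of_exponent_le (one_le_logWeight (Real.sqrt_nonneg t))
                  (by linarith)
            _ ≤ _ := le_mul_of_one_le_left (by positivity) (by linarith [Real.sqrt_nonneg t])
        have h6 : 2 * (Real.exp 1 * √t + 1) / β ≤
            (2 * Real.exp 1 / β + 2 / β) * (1 + √t) := by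
          have : (2 * Real.exp 1 / β + 2 / β) * (1 + √t) =
            2 * (Real.exp 1 * √t + 1) / β + 2 * Real.exp 1 / β + 2 * √t / β := by ring
          rw [this]
          have h7 : 0 ≤ 2 * Real.exp 1 / β := by positivity
          have h8 : 0 ≤ 2 * √t / β := by positivity
          linarith
        calc P * ‖z‖ ^ (-γ) * (2 * (Real.exp 1 * √t + 1) / β * logWeight (√t) ^ (-β)) +
            Q * J * ‖z‖ ^ (-γ) * (t ^ (1 - γ / 2) / (1 - γ / 2))
            = P * ‖z‖ ^ (-γ) * (2 * (Real.exp 1 * √t + 1) / β * logWeight (√t) ^ (-β)) +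
            Q * ‖z‖ ^ (-γ) * (1 - γ / 2)⁻¹ * (J * t ^ (1 - γ / 2)) := by ring
          _ ≤ P * ‖z‖ ^ (-γ) *
              ((2 * Real.exp 1 / β + 2 / β) * (1 + √t) * logWeight (√t) ^ (-β)) +
            Q * ‖z‖ ^ (-γ) * (1 - γ / 2)⁻¹ * ((1 + √t) * logWeight (√t) ^ (-β)) := by
              rw [h4]; gcongr
          _ = _ := by ring

end

section

variable {N : ℕ}

/-- The Duhamel term of the Hardy parabolic equation, for `[0, ∞]`-valued functions. -/
noncomputable def duhamel (γ p : ℝ) (v : EuclideanSpace ℝ (Fin N) → ℝ → ℝ≥0∞)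
    (x : EuclideanSpace ℝ (Fin N)) (t : ℝ) : ℝ≥0∞ :=
  ∫⁻ s in Ioo 0 t, ∫⁻ y, ENNReal.ofReal (heatKernel N (x - y) (t - s)) *
    (ENNReal.ofReal (‖y‖ ^ (-γ)) * v y s ^ p)

variable {γ p : ℝ} {v w : EuclideanSpace ℝ (Fin N) → ℝ → ℝ≥0∞}

lemma duhamel_mono (hp : 0 ≤ p) {x : EuclideanSpace ℝ (Fin N)} {t : ℝ}
    (h : ∀ y, ∀ s ∈ Ioo 0 t, v y s ≤ w y s) : duhamel γ p v x t ≤ duhamel γ p w x t := by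
  refine setLIntegral_mono' measurableSet_Ioo fun s hs ↦ lintegral_mono fun y ↦ ?_
  gcongr
  exact h y s hs

lemma measurable_duhamel_integrand (hv : Measurable (Function.uncurry v)) :
    Measurable fun r : ((EuclideanSpace ℝ (Fin N) × ℝ) × ℝ) × EuclideanSpace ℝ (Fin N) ↦
      ENNReal.ofReal (heatKernel N (r.1.1.1 - r.2) (r.1.1.2 - r.1.2)) *
        (ENNReal.ofReal (‖r.2‖ ^ (-γ)) * v r.2 r.1.2 ^ p) := by
  have h : Measurable fun r : ((EuclideanSpace ℝ (Fin N) × ℝ) × ℝ) × EuclideanSpace ℝ (Fin N) ↦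
      v r.2 r.1.2 := hv.comp (measurable_snd.prodMk (measurable_snd.comp measurable_fst))
  fun_prop

lemma measurable_duhamel_inner (hv : Measurable (Function.uncurry v)) :
    Measurable fun r : (EuclideanSpace ℝ (Fin N) × ℝ) × ℝ ↦
      ∫⁻ y, ENNReal.ofReal (heatKernel N (r.1.1 - y) (r.1.2 - r.2)) *
        (ENNReal.ofReal (‖y‖ ^ (-γ)) * v y r.2 ^ p) :=
  (measurable_duhamel_integrand hv).lintegral_prod_right'

lemma measurable_duhamel_inner_right (hv : Measurable (Function.uncurry v))
    (x : EuclideanSpace ℝ (Fin N)) (t : ℝ) :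
    Measurable fun s ↦ ∫⁻ y, ENNReal.ofReal (heatKernel N (x - y) (t - s)) *
        (ENNReal.ofReal (‖y‖ ^ (-γ)) * v y s ^ p) :=
  Measurable.of_uncurry_left (f := fun (q : EuclideanSpace ℝ (Fin N) × ℝ) s ↦
    ∫⁻ y, ENNReal.ofReal (heatKernel N (q.1 - y) (q.2 - s)) *
        (ENNReal.ofReal (‖y‖ ^ (-γ)) * v y s ^ p)) (measurable_duhamel_inner hv) (x := (x, t))

lemma measurable_duhamel (hv : Measurable (Function.uncurry v)) :
    Measurable (Function.uncurry (duhamel γ p v)) := by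
  have hS : MeasurableSet {r : (EuclideanSpace ℝ (Fin N) × ℝ) × ℝ | 0 < r.2 ∧ r.2 < r.1.2} :=
    (measurableSet_lt measurable_const measurable_snd).inter
      (measurableSet_lt measurable_snd (measurable_snd.comp measurable_fst))
  have h := ((measurable_duhamel_inner (γ := γ) (p := p) hv).indicator hS).lintegral_prod_right'
    (ν := volume)
  convert h using 1
  ext ⟨x, t⟩
  simp only [Function.uncurry, duhamel]
  rw [← lintegral_indicator measurableSet_Ioo]
  rfl

lemma duhamel_iSup (hp : 0 < p) {v : ℕ → EuclideanSpace ℝ (Fin N) → ℝ → ℝ≥0∞}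
    (hv : ∀ n, Measurable (Function.uncurry (v n))) (hm : Monotone v)
    (x : EuclideanSpace ℝ (Fin N)) (t : ℝ) :
    duhamel γ p (fun y s ↦ ⨆ n, v n y s) x t = ⨆ n, duhamel γ p (v n) x t := by
  unfold duhamel
  have hpow : ∀ y s, (⨆ n, v n y s) ^ p = ⨆ n, v n y s ^ p := fun y s ↦
    (ENNReal.orderIsoRpow p hp).map_iSup _
  rw [← lintegral_iSup]
  · refine lintegral_congr fun s ↦ ?_
    rw [← lintegral_iSup]
    · refine lintegral_congr fun y ↦ ?_
      rw [hpow, ENNReal.mul_iSup, ENNReal.mul_iSup]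
    · intro n
      have hvs : Measurable fun y ↦ v n y s := (hv n).of_uncurry_right
      have hk : Measurable fun y ↦ heatKernel N (x - y) (t - s) :=
        measurable_heatKernel_comp (by fun_prop) measurable_const
      fun_prop
    · intro m n hmn y
      dsimp only
      gcongr
      exact hm hmn y s
  · intro n
    exact measurable_duhamel_inner_right (hv n) x t
  · intro m n hmn s
    refine lintegral_mono fun y ↦ ?_
    gcongr
    exact hm hmn y s

/-- The Picard iterates of the integral equation. -/
noncomputable def picard (γ p : ℝ) (φ : EuclideanSpace ℝ (Fin N) → ℝ≥0∞) :
    ℕ → EuclideanSpace ℝ (Fin N) → ℝ → ℝ≥0∞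
  | 0 => fun _ _ ↦ 0
  | n + 1 => fun x t ↦ heatExt φ x t + duhamel γ p (picard γ p φ n) x t

variable {φ : EuclideanSpace ℝ (Fin N) → ℝ≥0∞}

lemma measurable_picard (hφ : Measurable φ) (n : ℕ) :
    Measurable (Function.uncurry (picard γ p φ n)) := by
  induction n with
  | zero => exact measurable_const
  | succ n ih => exact (measurable_heatExt hφ).add (measurable_duhamel ih)

lemma monotone_picard (hp : 0 ≤ p) : Monotone (picard γ p φ) := by
  refine monotone_nat_of_le_succ fun n ↦ ?_
  induction n with
  | zero => exact fun _ _ ↦ zero_le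
  | succ n ih => exact fun x t ↦ add_le_add le_rfl (duhamel_mono hp fun y s _ ↦ ih y s)

lemma iSup_picard_eq (hφ : Measurable φ) (hp : 0 < p) (x : EuclideanSpace ℝ (Fin N)) (t : ℝ) :
    ⨆ n, picard γ p φ n x t =
      heatExt φ x t + duhamel γ p (fun y s ↦ ⨆ n, picard γ p φ n y s) x t := by
  rw [duhamel_iSup hp (measurable_picard hφ) (monotone_picard hp.le), ENNReal.add_iSup,
    ← Monotone.iSup_nat_add (fun _ _ h ↦ monotone_picard hp.le h x t) 1]
  rfl

lemma picard_le {T : ℝ} (hp : 0 ≤ p)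
    (h : ∀ x, ∀ t ∈ Ioo 0 T, heatExt φ x t + duhamel γ p w x t ≤ w x t) (n : ℕ)
    (x : EuclideanSpace ℝ (Fin N)) {t : ℝ} (ht : t ∈ Ioo 0 T) : picard γ p φ n x t ≤ w x t := by
  induction n generalizing x t with
  | zero => exact zero_le
  | succ n ih =>
    refine le_trans ?_ (h x t ht)
    exact add_le_add le_rfl (duhamel_mono hp fun y s hs ↦ ih y ⟨hs.1, hs.2.trans ht.2⟩)

/-- The existence of a finite supersolution implies the existence of a solution. -/
theorem exists_isSol_of_supersolution {T : ℝ} (hp : 0 < p) {u₀ : EuclideanSpace ℝ (Fin N) → ℝ}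
    (hu : Measurable u₀) (hu0 : ∀ x, 0 ≤ u₀ x) (hw : ∀ x, ∀ t ∈ Ioo 0 T, w x t < ∞)
    (h : ∀ x, ∀ t ∈ Ioo 0 T,
      heatExt (fun y ↦ ENNReal.ofReal (u₀ y)) x t + duhamel γ p w x t ≤ w x t) :
    ∃ u, IsSol N γ p T u₀ u := by
  have hφ : Measurable fun y ↦ ENNReal.ofReal (u₀ y) := by fun_prop
  obtain ⟨W, hW⟩ : ∃ W : EuclideanSpace ℝ (Fin N) → ℝ → ℝ≥0∞,
    W = fun y s ↦ ⨆ n, picard γ p (fun y ↦ ENNReal.ofReal (u₀ y)) n y s := ⟨_, rfl⟩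
  have hWm : Measurable (Function.uncurry W) := by
    rw [hW]
    exact Measurable.iSup fun n ↦ measurable_picard hφ n
  have hWfin : ∀ x, ∀ t ∈ Ioo 0 T, W x t < ∞ := fun x t ht ↦ by
    rw [hW]
    exact (iSup_le fun n ↦ picard_le hp.le h n x ht).trans_lt (hw x t ht)
  have hWeq : ∀ x t, W x t =
      heatExt (fun y ↦ ENNReal.ofReal (u₀ y)) x t + duhamel γ p W x t := fun x t ↦ by
    rw [hW]; exact iSup_picard_eq hφ hp x t
  refine ⟨fun x t ↦ (W x t).toReal, hWm.ennreal_toReal, fun _ _ ↦ ENNReal.toReal_nonneg,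
    Filter.Eventually.of_forall fun ⟨x, t⟩ ht ↦ ?_⟩
  dsimp only at ht ⊢
  have hfin := hWfin x t ht
  rw [hWeq] at hfin
  obtain ⟨hfin1, hfin2⟩ := ENNReal.add_lt_top.1 hfin
  rw [hWeq, ENNReal.toReal_add hfin1.ne hfin2.ne]
  congr 1
  · have hk : Measurable fun y ↦ heatKernel N (x - y) t :=
      measurable_heatKernel_comp (by fun_prop) measurable_const
    rw [integral_eq_lintegral_of_nonneg_ae
      (Filter.Eventually.of_forall fun y ↦ mul_nonneg (heatKernel_nonneg _ ht.1.le) (hu0 y))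
      (hk.mul hu).aestronglyMeasurable]
    unfold heatExt
    simp_rw [ENNReal.ofReal_mul (heatKernel_nonneg _ ht.1.le)]
  · have hin : Measurable fun s ↦ ∫⁻ y, ENNReal.ofReal (heatKernel N (x - y) (t - s)) *
        (ENNReal.ofReal (‖y‖ ^ (-γ)) * W y s ^ p) :=
      measurable_duhamel_inner_right hWm x t
    unfold duhamel at hfin2 ⊢
    rw [← integral_toReal hin.aemeasurable (ae_lt_top hin hfin2.ne)]
    refine setIntegral_congr_fun measurableSet_Ioo fun s hs ↦ ?_
    have hts : 0 ≤ t - s := by linarith [hs.2]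
    have hk : Measurable fun y ↦ heatKernel N (x - y) (t - s) :=
      measurable_heatKernel_comp (by fun_prop) measurable_const
    have hWs : Measurable fun y ↦ W y s := hWm.of_uncurry_right
    rw [integral_eq_lintegral_of_nonneg_ae]
    · congr 1
      refine lintegral_congr fun y ↦ ?_
      rw [ENNReal.ofReal_mul (by have := heatKernel_nonneg (x - y) hts; positivity),
        ENNReal.ofReal_mul (heatKernel_nonneg _ hts), mul_assoc,
        ← ENNReal.ofReal_rpow_of_nonneg ENNReal.toReal_nonneg hp.le,
        ENNReal.ofReal_toReal (hWfin y s ⟨hs.1, hs.2.trans ht.2⟩).ne]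
    · refine Filter.Eventually.of_forall fun y ↦ ?_
      have := heatKernel_nonneg (x - y) hts
      dsimp only [Pi.zero_apply]
      positivity
    · exact Measurable.aestronglyMeasurable (by fun_prop)

end

section

variable {N : ℕ} {γ p : ℝ} {v w : EuclideanSpace ℝ (Fin N) → ℝ → ℝ≥0∞}

lemma duhamel_const_mul (hp : 0 ≤ p) {a : ℝ≥0∞} (ha : a ≠ ∞) (x : EuclideanSpace ℝ (Fin N))
    (t : ℝ) : duhamel γ p (fun y s ↦ a * v y s) x t = a ^ p * duhamel γ p v x t := by
  have hap : a ^ p ≠ ∞ := ENNReal.rpow_ne_top_of_nonneg hp ha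
  unfold duhamel
  rw [← lintegral_const_mul' _ _ hap]
  refine lintegral_congr fun s ↦ ?_
  rw [← lintegral_const_mul' _ _ hap]
  refine lintegral_congr fun y ↦ ?_
  rw [ENNReal.mul_rpow_of_nonneg _ _ hp]
  ring

lemma duhamel_add_le (hp : 1 ≤ p) (hw : Measurable (Function.uncurry w))
    (x : EuclideanSpace ℝ (Fin N)) (t : ℝ) :
    duhamel γ p (fun y s ↦ v y s + w y s) x t ≤
      2 ^ (p - 1) * (duhamel γ p v x t + duhamel γ p w x t) := by
  have h2 : (2 : ℝ≥0∞) ^ (p - 1) ≠ ∞ :=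
    ENNReal.rpow_ne_top_of_nonneg (by linarith) ENNReal.ofNat_ne_top
  unfold duhamel
  rw [← lintegral_add_right _ (measurable_duhamel_inner_right hw x t),
    ← lintegral_const_mul' _ _ h2]
  refine lintegral_mono fun s ↦ ?_
  have hk : Measurable fun y ↦ heatKernel N (x - y) (t - s) :=
    measurable_heatKernel_comp (by fun_prop) measurable_const
  have hws : Measurable fun y ↦ w y s := hw.of_uncurry_right
  rw [← lintegral_add_right _ (by fun_prop), ← lintegral_const_mul' _ _ h2]
  refine lintegral_mono fun y ↦ ?_
  calc _ ≤ ENNReal.ofReal (heatKernel N (x - y) (t - s)) * (ENNReal.ofReal (‖y‖ ^ (-γ)) *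
        (2 ^ (p - 1) * (v y s ^ p + w y s ^ p))) := by
        gcongr
        exact ENNReal.rpow_add_le_mul_rpow_add_rpow _ _ hp
    _ = _ := by ring

lemma exists_duhamel_const_le (hN : 1 ≤ N) (hγ0 : 0 < γ) (hγ2 : γ < 2) (hγN : γ < N) :
    ∃ C : ℝ, 0 < C ∧ ∀ (p K : ℝ) (x : EuclideanSpace ℝ (Fin N)) (t : ℝ), 0 ≤ p → 0 ≤ K → 0 < t →
      duhamel γ p (fun _ _ ↦ ENNReal.ofReal K) x t ≤
        ENNReal.ofReal (C * K ^ p * t ^ (1 - γ / 2)) := by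
  obtain ⟨C, hC, h⟩ := exists_lintegral_heatKernel_mul_norm_rpow_le hN hγ0 hγN
  have hγ' : 0 < 1 - γ / 2 := by linarith
  refine ⟨C / (1 - γ / 2), by positivity, fun p K x t hp hK ht ↦ ?_⟩
  have hKp : ENNReal.ofReal (C * K ^ p) ≠ ∞ := ENNReal.ofReal_ne_top
  unfold duhamel
  calc _ ≤ ∫⁻ s in Ioo 0 t, ENNReal.ofReal (C * K ^ p) * ENNReal.ofReal ((t - s) ^ (-(γ / 2))) := by
        refine setLIntegral_mono' measurableSet_Ioo fun s hs ↦ ?_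
        have hts : 0 < t - s := by linarith [hs.2]
        calc _ = ENNReal.ofReal (K ^ p) * ∫⁻ y, ENNReal.ofReal (heatKernel N (y - x) (t - s)) *
              ENNReal.ofReal (‖y‖ ^ (-γ)) := by
              rw [← lintegral_const_mul' _ _ ENNReal.ofReal_ne_top]
              refine lintegral_congr fun y ↦ ?_
              rw [ENNReal.ofReal_rpow_of_nonneg hK hp, heatKernel_sub_comm]
              ring
          _ ≤ ENNReal.ofReal (K ^ p) * ENNReal.ofReal (C * (t - s) ^ (-(γ / 2))) := by
              gcongr
              exact h x _ hts
          _ = _ := by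
              rw [← ENNReal.ofReal_mul (by positivity), ← ENNReal.ofReal_mul (by positivity)]
              congr 1; ring
    _ = ENNReal.ofReal (C * K ^ p) * ∫⁻ s in Ioo 0 t, ENNReal.ofReal ((t - s) ^ (-(γ / 2))) :=
        lintegral_const_mul' _ _ hKp
    _ ≤ ENNReal.ofReal (C * K ^ p) * ENNReal.ofReal (t ^ (1 - γ / 2) / (1 - γ / 2)) := by
        gcongr
        exact lintegral_sub_rpow_neg_le (by linarith)
    _ = _ := by
        rw [← ENNReal.ofReal_mul (by positivity)]
        congr 1; ring

lemma singSuper_lt_top (hN : 1 ≤ N) {β : ℝ} (hβ1 : β < N / 2)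
    (z x : EuclideanSpace ℝ (Fin N)) {t : ℝ} (ht : 0 < t) : singSuper β z x t < ∞ := by
  have hN0 : (0 : ℝ) < N := by exact_mod_cast hN
  have hk : ∀ y, ‖y - z‖ < √t / 4 → heatKernel N (x - y) t ≤ 1 * √t ^ (-(N : ℝ)) := by
    intro y _
    have e : √t ^ (-(N : ℝ)) = t ^ (-(N : ℝ) / 2) := by
      rw [Real.sqrt_eq_rpow, ← Real.rpow_mul ht.le]; congr 1; ring
    rw [e, one_mul]
    exact heatKernel_le_rpow _ ht
  have hfin : ∀ κ : ℝ, 0 < κ → heatExt (singData κ z) x t < ∞ := fun κ hκ ↦ by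
    obtain ⟨C, -, h⟩ := exists_heatExt_singData_le hN hκ one_pos
    exact (h z x (√t) t (Real.sqrt_pos.2 ht) ht hk).trans_lt ENNReal.ofReal_lt_top
  exact ENNReal.add_lt_top.2 ⟨hfin _ (by positivity),
    ENNReal.mul_lt_top ENNReal.ofReal_lt_top (hfin _ (by linarith))⟩

lemma heatExt_le_of_le_logSing (hN : 1 ≤ N) {z : EuclideanSpace ℝ (Fin N)}
    {u₀ : EuclideanSpace ℝ (Fin N) → ℝ} {κ a b : ℝ} (ha : 0 ≤ a) (hb : 0 ≤ b)
    (h : ∀ x, x ≠ z → u₀ x ≤ a * logSing N κ ‖x - z‖ + b) (x : EuclideanSpace ℝ (Fin N)) {t : ℝ}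
    (ht : 0 < t) :
    heatExt (fun y ↦ ENNReal.ofReal (u₀ y)) x t ≤
      ENNReal.ofReal a * heatExt (singData κ z) x t + ENNReal.ofReal b := by
  have : Nonempty (Fin N) := ⟨⟨0, hN⟩⟩
  have hm := measurable_singData (N := N) κ z
  calc _ ≤ heatExt (fun y ↦ ENNReal.ofReal a * singData κ z y + ENNReal.ofReal b) x t := by
        refine lintegral_mono_ae ?_
        filter_upwards [compl_mem_ae_iff.2 (measure_singleton z)] with y hy
        gcongr
        refine (ENNReal.ofReal_le_ofReal (h y hy)).trans_eq ?_
        have := logSing_nonneg N κ (norm_nonneg (y - z))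
        rw [ENNReal.ofReal_add (by positivity) hb, ENNReal.ofReal_mul ha]
        rfl
    _ = _ := by
        rw [heatExt_add (hm.const_mul _), heatExt_const_mul hm, heatExt_const _ _ ht]

lemma weight_le_norm_rpow {θ : ℝ} (hθ : 0 < θ) (hγ2 : γ < 2) {r : ℝ} (hr : 0 < r) :
    (if 2 < N then r ^ (γ / θ) else r ^ (2 / θ) * (1 + r) ^ (-(2 - γ) / θ)) ≤ r ^ (γ / θ) := by
  split_ifs
  · exact le_rfl
  · calc _ ≤ r ^ (2 / θ) * r ^ (-(2 - γ) / θ) := by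
          gcongr 1
          refine Real.rpow_le_rpow_of_nonpos hr (by linarith) ?_
          exact div_nonpos_of_nonpos_of_nonneg (by linarith) hθ.le
      _ = _ := by rw [← Real.rpow_add hr]; congr 1; ring

end

theorem statement2 (N : ℕ) (hN : 1 ≤ N) (γ p : ℝ)
    (hγ0 : 0 < γ) (hγ : γ < min 2 (N : ℝ)) (hp : p = 1 + 2 / (N : ℝ)) :
    ∃ cstar Cstar : ℝ, 0 < cstar ∧ 0 < Cstar ∧
      ∀ (T : ℝ), 0 < T →
      ∀ (z : EuclideanSpace ℝ (Fin N)), z ≠ 0 →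
      ∀ (u₀ : EuclideanSpace ℝ (Fin N) → ℝ) (c C₀ : ℝ),
        Measurable u₀ → (∀ x, 0 ≤ u₀ x) →
        0 < c →
        c ≤ cstar * (1 + T ^ ((1 : ℝ) / 2) + T ^ (1 - γ / 2)) ^ (-1 / (p - 1)) →
        0 ≤ C₀ → C₀ ≤ Cstar * T ^ (-(2 - γ) / (2 * (p - 1))) →
        (∀ x, x ≠ z →
          u₀ x ≤ c *
              (if 2 < N then ‖z‖ ^ (γ / (p - 1))
               else ‖z‖ ^ (2 / (p - 1)) * (1 + ‖z‖) ^ (-(2 - γ) / (p - 1))) *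
              (‖x - z‖ ^ (-(N : ℝ)) *
                Real.log (Real.exp 1 + ‖x - z‖⁻¹) ^ (-(N : ℝ) / 2 - 1) *
                Set.indicator (Set.Icc (0 : ℝ) 1) (fun _ => (1 : ℝ)) ‖x - z‖) + C₀) →
        ∃ u, IsSol N γ p T u₀ u := by
  have hN1 : (1 : ℝ) ≤ N := by exact_mod_cast hN
  have hγ2 : γ < 2 := hγ.trans_le (min_le_left _ _)
  have hγN : γ < N := hγ.trans_le (min_le_right _ _)
  obtain ⟨θ, hθ⟩ : ∃ θ, θ = p - 1 := ⟨_, rfl⟩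
  have hpθ : p = 1 + θ := by linarith
  have hθN : θ = 2 / N := by linarith
  have hθ0 : 0 < θ := by rw [hθN]; positivity
  rw [← hθ]
  obtain ⟨β, hβ⟩ : ∃ β : ℝ, β = 1 / (N + 2) := ⟨_, rfl⟩
  have hβ0 : 0 < β := by rw [hβ]; positivity
  have hβ1 : β < N / 2 := by
    rw [hβ, div_lt_div_iff₀ (by linarith) two_pos]; nlinarith
  have hβ2 : β ≤ 2 / N := by
    rw [hβ, div_le_div_iff₀ (by linarith) (by linarith)]; nlinarith
  obtain ⟨C₁, hC₁, h₁⟩ := exists_duhamel_singSuper_le hN hβ0 hβ1 hβ2 hγ0 hγ2 hγN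
  obtain ⟨C₂, hC₂, h₂⟩ := exists_duhamel_const_le hN hγ0 hγ2 hγN
  refine ⟨(2 ^ θ * C₁) ^ (-1 / θ), (2 ^ θ * 2 ^ p * C₂) ^ (-1 / θ), by positivity, by positivity,
    fun T hT z hz u₀ c C₀ hu hu0 hc hcT hC₀ hC₀T hbound ↦ ?_⟩
  have hd : 0 < ‖z‖ := norm_pos_iff.2 hz
  obtain ⟨a, ha⟩ : ∃ a, a = c * ‖z‖ ^ (γ / θ) := ⟨_, rfl⟩
  have ha0 : 0 < a := by rw [ha]; positivity
  have hbound' : ∀ x, x ≠ z → u₀ x ≤ a * logSing N (N / 2) ‖x - z‖ + C₀ := fun x hx ↦ by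
    have h0 := logSing_nonneg N (N / 2) (norm_nonneg (x - z))
    have e : -(N : ℝ) / 2 - 1 = -1 - N / 2 := by ring
    refine (hbound x hx).trans ?_
    rw [e, ha]
    change _ * logSing N (N / 2) ‖x - z‖ + _ ≤ _
    gcongr
    exact weight_le_norm_rpow hθ0 hγ2 hd
  have hpow : ∀ r : ℝ, 0 < r → (r ^ (-1 / θ)) ^ θ = r⁻¹ := fun r hr ↦ by
    rw [← Real.rpow_mul hr.le, div_mul_cancel₀ _ hθ0.ne', Real.rpow_neg_one]
  have hcθ : 2 ^ θ * C₁ * c ^ θ * (1 + √T) ≤ 1 := by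
    have hM : 0 < 1 + T ^ ((1 : ℝ) / 2) + T ^ (1 - γ / 2) := by positivity
    have h := Real.rpow_le_rpow hc.le hcT hθ0.le
    rw [Real.mul_rpow (by positivity) (by positivity), hpow _ (by positivity), hpow _ hM] at h
    have hMT : 1 + √T ≤ 1 + T ^ ((1 : ℝ) / 2) + T ^ (1 - γ / 2) := by
      rw [Real.sqrt_eq_rpow]
      exact le_add_of_nonneg_right (by positivity)
    calc _ ≤ 2 ^ θ * C₁ * ((2 ^ θ * C₁)⁻¹ * (1 + T ^ ((1 : ℝ) / 2) + T ^ (1 - γ / 2))⁻¹) *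
          (1 + T ^ ((1 : ℝ) / 2) + T ^ (1 - γ / 2)) := by gcongr
      _ = 1 := by field_simp
  have hC₀θ : 2 ^ θ * 2 ^ p * C₂ * C₀ ^ θ * T ^ (1 - γ / 2) ≤ 1 := by
    have h := Real.rpow_le_rpow hC₀ hC₀T hθ0.le
    have e : -(2 - γ) / (2 * θ) * θ = -(1 - γ / 2) := by field_simp
    rw [Real.mul_rpow (by positivity) (by positivity), hpow _ (by positivity),
      ← Real.rpow_mul hT.le, e, Real.rpow_neg hT.le] at h
    calc _ ≤ 2 ^ θ * 2 ^ p * C₂ * ((2 ^ θ * 2 ^ p * C₂)⁻¹ * (T ^ (1 - γ / 2))⁻¹) *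
          T ^ (1 - γ / 2) := by gcongr
      _ = 1 := by field_simp
  have hp0 : 0 < p := by linarith
  refine exists_isSol_of_supersolution
    (w := fun x t ↦ ENNReal.ofReal a * singSuper β z x t + ENNReal.ofReal (2 * C₀))
    hp0 hu hu0 (fun x t ht ↦ ?_) (fun x t ht ↦ ?_)
  · exact ENNReal.add_lt_top.2 ⟨ENNReal.mul_lt_top ENNReal.ofReal_lt_top
      (singSuper_lt_top hN hβ1 z x ht.1), ENNReal.ofReal_lt_top⟩
  obtain ⟨V, hV⟩ : ∃ V, V = ENNReal.ofReal (logWeight (√t) ^ (-β)) *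
    heatExt (singData (N / 2 - β) z) x t := ⟨_, rfl⟩
  have hlin := heatExt_le_of_le_logSing hN ha0.le hC₀ hbound' x ht.1
  have hsing : 2 ^ θ * (a ^ p * (C₁ * (1 + √t) * ‖z‖ ^ (-γ))) ≤ a := by
    have e1 : a ^ p = a * (c ^ θ * ‖z‖ ^ γ) := by
      rw [hpθ, Real.rpow_add ha0, Real.rpow_one]
      congr 1
      rw [ha, Real.mul_rpow hc.le (by positivity), ← Real.rpow_mul hd.le,
        div_mul_cancel₀ _ hθ0.ne']
    have e2 : ‖z‖ ^ γ * ‖z‖ ^ (-γ) = 1 := by rw [← Real.rpow_add hd]; simp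
    calc _ = a * (2 ^ θ * C₁ * c ^ θ * (1 + √t)) * (‖z‖ ^ γ * ‖z‖ ^ (-γ)) := by rw [e1]; ring
      _ = a * (2 ^ θ * C₁ * c ^ θ * (1 + √t)) := by rw [e2, mul_one]
      _ ≤ a * (2 ^ θ * C₁ * c ^ θ * (1 + √T)) := by
          gcongr
          exact ht.2.le
      _ ≤ a := mul_le_of_le_one_right ha0.le hcθ
  have hconst : 2 ^ θ * (C₂ * (2 * C₀) ^ p * t ^ (1 - γ / 2)) ≤ C₀ := by
    have e1 : C₀ ^ p = C₀ * C₀ ^ θ := by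
      rw [hpθ, Real.rpow_add_of_nonneg hC₀ zero_le_one hθ0.le, Real.rpow_one]
    have ht0 := ht.1
    calc _ = C₀ * (2 ^ θ * 2 ^ p * C₂ * C₀ ^ θ * t ^ (1 - γ / 2)) := by
          rw [Real.mul_rpow zero_le_two hC₀, e1]; ring
      _ ≤ C₀ * (2 ^ θ * 2 ^ p * C₂ * C₀ ^ θ * T ^ (1 - γ / 2)) := by
          gcongr
          · linarith
          · exact ht.2.le
      _ ≤ C₀ := mul_le_of_le_one_right hC₀ hC₀θ
  have hduh : duhamel γ p
      (fun x t ↦ ENNReal.ofReal a * singSuper β z x t + ENNReal.ofReal (2 * C₀)) x t ≤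
      ENNReal.ofReal a * V + ENNReal.ofReal C₀ := by
    have hs : duhamel γ p (singSuper β z) x t ≤
        ENNReal.ofReal (C₁ * (1 + √t) * ‖z‖ ^ (-γ)) * V := by
      rw [hV, hp]
      exact h₁ z x t hz ht.1
    have h2θ : (2 : ℝ≥0∞) ^ (p - 1) = ENNReal.ofReal (2 ^ θ) := by
      rw [← ENNReal.ofReal_rpow_of_pos two_pos, ← hθ]; simp
    calc _ ≤ 2 ^ (p - 1) * (duhamel γ p (fun x t ↦ ENNReal.ofReal a * singSuper β z x t) x t +
          duhamel γ p (fun _ _ ↦ ENNReal.ofReal (2 * C₀)) x t) :=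
          duhamel_add_le (by linarith) measurable_const x t
      _ ≤ ENNReal.ofReal (2 ^ θ) * (ENNReal.ofReal (a ^ p) *
            (ENNReal.ofReal (C₁ * (1 + √t) * ‖z‖ ^ (-γ)) * V) +
          ENNReal.ofReal (C₂ * (2 * C₀) ^ p * t ^ (1 - γ / 2))) := by
          rw [h2θ, duhamel_const_mul hp0.le ENNReal.ofReal_ne_top,
            ENNReal.ofReal_rpow_of_pos ha0]
          gcongr
          exact h₂ p (2 * C₀) x t hp0.le (by positivity) ht.1
      _ = ENNReal.ofReal (2 ^ θ * (a ^ p * (C₁ * (1 + √t) * ‖z‖ ^ (-γ)))) * V +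
          ENNReal.ofReal (2 ^ θ * (C₂ * (2 * C₀) ^ p * t ^ (1 - γ / 2))) := by
          have ha' : 0 ≤ a ^ p := by positivity
          have h2' : (0 : ℝ) ≤ 2 ^ θ := by positivity
          rw [ENNReal.ofReal_mul (p := 2 ^ θ) h2', ENNReal.ofReal_mul (p := 2 ^ θ) h2',
            ENNReal.ofReal_mul (p := a ^ p) ha', mul_add]
          simp only [mul_assoc]
      _ ≤ _ := by gcongr
  calc _ ≤ (ENNReal.ofReal a * heatExt (singData (N / 2) z) x t + ENNReal.ofReal C₀) +
        (ENNReal.ofReal a * V + ENNReal.ofReal C₀) := add_le_add hlin hduh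
    _ = ENNReal.ofReal a * (heatExt (singData (N / 2) z) x t + V) + ENNReal.ofReal (2 * C₀) := by
        rw [two_mul, ENNReal.ofReal_add hC₀ hC₀]; ring
    _ = _ := by rw [hV]; rfl
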